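/- Let (R, 𝔪) be an excellent Noetherian local Cohen–Macaulay domain of prime characteristic p > 0 with residue field k = R/𝔪, and suppose R has an isolated singularity (R_𝔭 regular for all primes 𝔭 ≠ 𝔪) or has Krull dimension at most 2. If Tor_j^R(R^+, k) = 0 for some j ≥ 1, then R is a regular local ring. -/

import Mathlib

set_option synthInstance.maxHeartbeats 1000000
set_option maxHeartbeats 1000000
set_option linter.unusedVariables false

open CategoryTheory

/-- `Tor_n^R(M, N)`, the `n`-th Tor group of the `R`-modules `M` and `N`. -/
noncomputable abbrev TorGrp (R : Type) [CommRing R] (n : ℕ)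
    (M N : Type) [AddCommGroup M] [Module R M] [AddCommGroup N] [Module R N] : Type :=
  ((Tor (ModuleCat R) n).obj (ModuleCat.of R M)).obj (ModuleCat.of R N)

/-- The absolute integral closure `R⁺` of a domain `R`: the integral closure of `R`
in an algebraic closure of its fraction field. -/
noncomputable abbrev AbsIntClo (R : Type) [CommRing R] [IsDomain R] : Type :=
  integralClosure R (AlgebraicClosure (FractionRing R))

/-- A regular local ring: a Noetherian local ring whose maximal ideal can be generated
by Krull-dimension many elements. -/
def IsRegularLocalRingP (A : Type) [CommRing A] : Prop :=
  IsNoetherianRing A ∧ ∃ h : IsLocalRing A, ∃ s : Finset A,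
    Ideal.span (s : Set A) = @IsLocalRing.maximalIdeal A _ h ∧
      (s.card : WithBot ℕ∞) = ringKrullDim A

/-- A regular ring: a Noetherian ring all of whose localizations at primes are
regular local rings. -/
def IsRegularRingP (A : Type) [CommRing A] : Prop :=
  IsNoetherianRing A ∧
    ∀ (p : Ideal A) (hp : p.IsPrime),
      haveI := hp
      IsRegularLocalRingP (Localization.AtPrime p)

/-- A chain of primes is saturated if each step is a covering relation. -/
def IsSaturatedChain {α : Type} [Preorder α] (c : LTSeries α) : Prop :=
  ∀ i : Fin c.length, c.toFun i.castSucc ⋖ c.toFun i.succ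

/-- A ring is catenary if any two saturated chains of primes with the same endpoints
have the same length. -/
def IsCatenaryRing (A : Type) [CommRing A] : Prop :=
  ∀ c₁ c₂ : LTSeries (PrimeSpectrum A),
    c₁.head = c₂.head → c₁.last = c₂.last →
      IsSaturatedChain c₁ → IsSaturatedChain c₂ → c₁.length = c₂.length

/-- A ring is universally catenary if every finitely generated algebra over it
(i.e. every quotient of a polynomial ring over it) is catenary. -/
def IsUniversallyCatenary (A : Type) [CommRing A] : Prop :=
  ∀ (n : ℕ) (I : Ideal (MvPolynomial (Fin n) A)),
    IsCatenaryRing (MvPolynomial (Fin n) A ⧸ I)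

/-- A `κ`-algebra `B` is geometrically regular if `L ⊗_κ B` is a regular ring for
every finite field extension `L` of `κ`. -/
def IsGeometricallyRegularAlgebra (κ : Type) [Field κ] (B : Type) [CommRing B]
    [Algebra κ B] : Prop :=
  ∀ (L : Type) (_ : Field L) (_ : Algebra κ L) (_ : Module.Finite κ L),
    IsRegularRingP (TensorProduct κ L B)

/-- A ring `A` is a G-ring if for every prime `p` of `A`, all fibers of the completion
map `A_p → (A_p)^∧` are geometrically regular; the fiber at a prime `q` of `A_p` is
`κ(q) ⊗_{A_p} (A_p)^∧`. -/
def IsGRing (A : Type) [CommRing A] : Prop :=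
  ∀ (p : Ideal A) (hp : p.IsPrime),
    haveI := hp
    ∀ (q : Ideal (Localization.AtPrime p)) (hq : q.IsPrime),
      haveI := hq
      IsGeometricallyRegularAlgebra
        (IsLocalRing.ResidueField (Localization.AtPrime q))
        (TensorProduct (Localization.AtPrime p)
          (IsLocalRing.ResidueField (Localization.AtPrime q))
          (AdicCompletion (IsLocalRing.maximalIdeal (Localization.AtPrime p))
            (Localization.AtPrime p)))

/-- A ring `A` is J-2 if the regular locus of every finitely generated `A`-algebra
is open in its prime spectrum. -/
def IsJ2 (A : Type) [CommRing A] : Prop :=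
  ∀ (n : ℕ) (I : Ideal (MvPolynomial (Fin n) A)),
    IsOpen {p : PrimeSpectrum (MvPolynomial (Fin n) A ⧸ I) |
      IsRegularLocalRingP (Localization.AtPrime p.asIdeal)}

/-- A ring is excellent if it is Noetherian, universally catenary, a G-ring, and J-2. -/
def IsExcellentRing (A : Type) [CommRing A] : Prop :=
  IsNoetherianRing A ∧ IsUniversallyCatenary A ∧ IsGRing A ∧ IsJ2 A

/-- A list of elements of a local ring is a system of parameters if its elements lie in
the maximal ideal, its length is the Krull dimension, and the ideal it generates has
radical the maximal ideal (i.e. is primary to the maximal ideal). -/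
def IsSystemOfParameters (R : Type) [CommRing R] [IsLocalRing R] (rs : List R) : Prop :=
  (∀ x ∈ rs, x ∈ IsLocalRing.maximalIdeal R) ∧
    (rs.length : WithBot ℕ∞) = ringKrullDim R ∧
    (Ideal.ofList rs).radical = IsLocalRing.maximalIdeal R

/-- A local ring is Cohen-Macaulay if it is Noetherian and admits a regular sequence of
length equal to its Krull dimension consisting of elements of the maximal ideal. -/
def IsCohenMacaulayLocalRing (R : Type) [CommRing R] : Prop :=
  IsNoetherianRing R ∧ ∃ h : IsLocalRing R,
    ∃ rs : List R, (∀ x ∈ rs, x ∈ @IsLocalRing.maximalIdeal R _ h) ∧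
      RingTheory.Sequence.IsRegular R rs ∧ (rs.length : WithBot ℕ∞) = ringKrullDim R

/-- An `R`-algebra `S` is a big Cohen-Macaulay `R`-algebra if some system of parameters
of `R` is an `S`-regular sequence. -/
def IsBigCohenMacaulayAlgebra (R : Type) [CommRing R] [IsLocalRing R]
    (S : Type) [CommRing S] [Algebra R S] : Prop :=
  ∃ rs : List R, IsSystemOfParameters R rs ∧ RingTheory.Sequence.IsRegular S rs

section TorOne

universe u

open TensorProduct Function

variable (R : Type u) [CommRing R]

/-- The vanishing of `Tor₁(U, N)`: tensoring with `U` preserves the injectivity of every kernel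
of a surjection onto `N`. -/
def TorOneVanishes (U N : Type u) [AddCommGroup U] [Module R U] [AddCommGroup N] [Module R N] :
    Prop :=
  ∀ (A B : Type u) [AddCommGroup A] [Module R A] [AddCommGroup B] [Module R B]
    (f : A →ₗ[R] B) (g : B →ₗ[R] N), Injective f → Exact f g → Surjective g →
      Injective (f.lTensor U)

variable {R}
variable {U N L A B C F M K : Type u}
  [AddCommGroup U] [Module R U] [AddCommGroup N] [Module R N] [AddCommGroup L] [Module R L]
  [AddCommGroup A] [Module R A] [AddCommGroup B] [Module R B] [AddCommGroup C] [Module R C]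
  [AddCommGroup F] [Module R F] [AddCommGroup M] [Module R M] [AddCommGroup K] [Module R K]

lemma lTensor_rTensor_comm_apply (f : A →ₗ[R] B) (g : M →ₗ[R] N) (z : A ⊗[R] M) :
    g.lTensor B (f.rTensor M z) = f.rTensor N (g.lTensor A z) := by
  rw [← LinearMap.comp_apply, ← LinearMap.comp_apply, LinearMap.lTensor_comp_rTensor,
    LinearMap.rTensor_comp_lTensor]

lemma lTensor_rTensor_comm (f : A →ₗ[R] B) (g : M →ₗ[R] N) :
    ⇑(g.lTensor B) ∘ ⇑(f.rTensor M) = ⇑(f.rTensor N) ∘ ⇑(g.lTensor A) :=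
  funext (lTensor_rTensor_comm_apply f g)

lemma TorOneVanishes.of_projective [Module.Projective R F] {i : M →ₗ[R] F} {π : F →ₗ[R] N}
    (hex : Exact i π) (hπ : Surjective π)
    (h : Injective (i.lTensor U)) : TorOneVanishes R U N := by
  intro A B _ _ _ _ f g hf hfg hg
  obtain ⟨l, hl⟩ := Module.projective_lifting_property g π hg
  have hlx (x) : g (l x) = π x := LinearMap.congr_fun hl x
  have hkey : ∀ m : M, ∃ a, f a = l (i m) := fun m ↦
    (hfg _).1 (by rw [hlx]; exact hex.apply_apply_eq_zero m)
  choose k hk using hkey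
  let k' : M →ₗ[R] A :=
    { toFun := k
      map_add' := fun x y ↦ hf (by simp [hk])
      map_smul' := fun r x ↦ hf (by simp [hk]) }
  let s : F × A →ₗ[R] B := l.coprod f
  let t : M →ₗ[R] F × A := i.prod (-k')
  have hs : Surjective s := by
    intro b
    obtain ⟨x, hx⟩ := hπ (g b)
    obtain ⟨a, ha⟩ := (hfg (b - l x)).1 (by rw [map_sub, hlx, hx, sub_self])
    exact ⟨(x, a), by simp [s, ha]⟩
  have hts : Exact t s := by
    rintro ⟨x, a⟩
    constructor
    · intro h0
      have h0' : l x + f a = 0 := by simpa [s] using h0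
      obtain ⟨m, rfl⟩ := (hex x).1 (by
        rw [← hlx, eq_neg_of_add_eq_zero_left h0', map_neg, hfg.apply_apply_eq_zero, neg_zero])
      refine ⟨m, ?_⟩
      have : a = -k m := hf (by rw [map_neg, hk]; exact eq_neg_of_add_eq_zero_right h0')
      simp [t, k', this]
    · rintro ⟨m, hm⟩
      have h1 : i m = x := congrArg Prod.fst hm
      have h2 : -k m = a := congrArg Prod.snd hm
      simp [s, ← h1, ← h2, hk]
  rw [injective_iff_map_eq_zero]
  intro z hz
  have hz' : s.lTensor U ((LinearMap.inr R F A).lTensor U z) = 0 := by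
    rw [← LinearMap.comp_apply, ← LinearMap.lTensor_comp]
    simpa [s] using hz
  obtain ⟨w, hw⟩ := (lTensor_exact U hts hs _).1 hz'
  have hw0 : i.lTensor U w = 0 := by
    have := congrArg ((LinearMap.fst R F A).lTensor U) hw
    rw [← LinearMap.comp_apply, ← LinearMap.comp_apply, ← LinearMap.lTensor_comp,
      ← LinearMap.lTensor_comp] at this
    simpa [t] using this
  have : w = 0 := h (by rw [hw0, map_zero])
  subst this
  have := congrArg ((LinearMap.snd R F A).lTensor U) hw
  rw [map_zero, map_zero, ← LinearMap.comp_apply, ← LinearMap.lTensor_comp] at this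
  simpa using this.symm

variable (R N) in
/-- The kernel of the canonical free cover of `N`. -/
def FreeSyzygy : Type u := LinearMap.ker (Finsupp.linearCombination R (id : N → N))

noncomputable instance : AddCommGroup (FreeSyzygy R N) :=
  inferInstanceAs (AddCommGroup (LinearMap.ker (Finsupp.linearCombination R (id : N → N))))

noncomputable instance : Module R (FreeSyzygy R N) :=
  inferInstanceAs (Module R (LinearMap.ker (Finsupp.linearCombination R (id : N → N))))

variable (R N) in
/-- The inclusion of the syzygy module into the canonical free cover. -/
noncomputable def FreeSyzygy.incl : FreeSyzygy R N →ₗ[R] N →₀ R :=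
  (LinearMap.ker (Finsupp.linearCombination R (id : N → N))).subtype

variable (R N) in
/-- The canonical free cover. -/
noncomputable def FreeSyzygy.cover : (N →₀ R) →ₗ[R] N := Finsupp.linearCombination R id

variable (R N) in
lemma FreeSyzygy.incl_injective : Injective (FreeSyzygy.incl R N) := Subtype.val_injective

variable (R N) in
lemma FreeSyzygy.cover_surjective : Surjective (FreeSyzygy.cover R N) :=
  Finsupp.linearCombination_id_surjective R N

variable (R N) in
lemma FreeSyzygy.exact : Exact (FreeSyzygy.incl R N) (FreeSyzygy.cover R N) :=
  LinearMap.exact_subtype_ker_map _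

/-- The horseshoe diagram: a surjection `π` from `F` onto the middle of a short exact
sequence, the kernel `K` of `π` and the kernel `M` of the composite `F → C`. -/
lemma exists_kernel_diagram {f : A →ₗ[R] B} {g : B →ₗ[R] C} (hfg : Exact f g)
    (hf : Injective f) {i : K →ₗ[R] F} {π : F →ₗ[R] B} (hi : Injective i)
    (hex : Exact i π) (hπ : Surjective π) :
    ∃ (M : Type u) (_ : AddCommGroup M) (_ : Module R M) (s : M →ₗ[R] F) (j : K →ₗ[R] M)
      (k : M →ₗ[R] A), Injective s ∧ Exact s (g ∘ₗ π) ∧ Injective j ∧ Exact j k ∧ Surjective k ∧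
        s ∘ₗ j = i ∧ f ∘ₗ k = π ∘ₗ s := by
  let M := LinearMap.ker (g ∘ₗ π)
  have hkey : ∀ m : M, ∃ a, f a = π m := fun m ↦ (hfg _).1 m.2
  choose k hk using hkey
  let k' : M →ₗ[R] A :=
    { toFun := k
      map_add' := fun x y ↦ hf (by simp [hk])
      map_smul' := fun r x ↦ hf (by simp [hk]) }
  let j : K →ₗ[R] M := i.codRestrict M fun x ↦ by
    simp [M, hex.apply_apply_eq_zero]
  refine ⟨M, inferInstance, inferInstance, M.subtype, j, k', M.injective_subtype,
    LinearMap.exact_subtype_ker_map _, fun x y h ↦ hi (congrArg Subtype.val h), ?_, ?_, ?_,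
    LinearMap.ext hk⟩
  · intro m
    constructor
    · intro hm
      obtain ⟨x, hx⟩ := (hex m).1 ((hk m).symm.trans ((congrArg f hm).trans (map_zero f)))
      exact ⟨x, Subtype.ext hx⟩
    · rintro ⟨x, rfl⟩
      exact hf ((hk _).trans (by rw [map_zero]; exact hex.apply_apply_eq_zero x))
  · intro a
    obtain ⟨x, hx⟩ := hπ (f a)
    exact ⟨⟨x, by simp [M, hx, hfg.apply_apply_eq_zero]⟩, hf ((hk _).trans hx)⟩
  · exact LinearMap.ext fun _ ↦ rfl

lemma TorOneVanishes.of_exact {f : A →ₗ[R] B} {g : B →ₗ[R] C} (hfg : Exact f g)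
    (hf : Injective f)
    (hg : Surjective g) (hB : TorOneVanishes R U B) (h : Injective (f.lTensor U)) :
    TorOneVanishes R U C := by
  have hπ := FreeSyzygy.cover_surjective R B
  have hBi := hB _ _ _ _ (FreeSyzygy.incl_injective R B) (FreeSyzygy.exact R B) hπ
  obtain ⟨M, _, _, s, j, k, hs, hsex, hj, hjk, hk, hsj, hfk⟩ := exists_kernel_diagram hfg hf
    (FreeSyzygy.incl_injective R B) (FreeSyzygy.exact R B) hπ
  refine TorOneVanishes.of_projective hsex (hg.comp hπ) ?_
  rw [injective_iff_map_eq_zero]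
  intro z hz
  have h1 : k.lTensor U z = 0 := by
    refine h ?_
    rw [← LinearMap.comp_apply, ← LinearMap.lTensor_comp, hfk, LinearMap.lTensor_comp,
      LinearMap.comp_apply, hz, map_zero, map_zero]
  obtain ⟨w, rfl⟩ := (lTensor_exact U hjk hk _).1 h1
  have : w = 0 := hBi (by
    rw [map_zero, ← hz, ← LinearMap.comp_apply, ← LinearMap.lTensor_comp, hsj])
  rw [this, map_zero]

lemma TorOneVanishes.of_flat_left [Module.Flat R U] : TorOneVanishes R U N :=
  fun _ _ _ _ _ _ f _ hf _ _ ↦ Module.Flat.lTensor_preserves_injective_linearMap f hf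

lemma TorOneVanishes.symm (h : TorOneVanishes R U N) : TorOneVanishes R N U := by
  have hπ := FreeSyzygy.cover_surjective R U
  have hρ := FreeSyzygy.cover_surjective R N
  have hex := FreeSyzygy.exact R U
  have hexρ := FreeSyzygy.exact R N
  have hM := h _ _ _ _ (FreeSyzygy.incl_injective R N) hexρ hρ
  refine TorOneVanishes.of_projective hex hπ ?_
  rw [LinearMap.lTensor_inj_iff_rTensor_inj, injective_iff_map_eq_zero]
  intro z hz
  obtain ⟨z', rfl⟩ := LinearMap.lTensor_surjective _ hρ z
  rw [← lTensor_rTensor_comm_apply] at hz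
  obtain ⟨y, hy⟩ := (lTensor_exact _ hexρ hρ _).1 hz
  have hy0 : (FreeSyzygy.cover R U).rTensor _ y = 0 := by
    refine hM ?_
    rw [lTensor_rTensor_comm_apply, hy, map_zero, ← LinearMap.comp_apply, ← LinearMap.rTensor_comp,
      hex.linearMap_comp_eq_zero, LinearMap.rTensor_zero, LinearMap.zero_apply]
  obtain ⟨y', rfl⟩ := (rTensor_exact _ hex hπ _).1 hy0
  rw [lTensor_rTensor_comm_apply] at hy
  have := Module.Flat.rTensor_preserves_injective_linearMap (M := N →₀ R) _
    (FreeSyzygy.incl_injective R U) hy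
  rw [← this, ← LinearMap.comp_apply, ← LinearMap.lTensor_comp, hexρ.linearMap_comp_eq_zero,
    LinearMap.lTensor_zero, LinearMap.zero_apply]

lemma TorOneVanishes.of_flat_right [Module.Flat R N] : TorOneVanishes R U N :=
  TorOneVanishes.of_flat_left.symm

lemma TorOneVanishes.congr (e : M ≃ₗ[R] N) (h : TorOneVanishes R U M) : TorOneVanishes R U N :=
  h.of_exact (f := (0 : PUnit.{u + 1} →ₗ[R] M)) (g := e.toLinearMap)
    (fun x ↦ by simp [eq_comm (a := (0 : M))]) (injective_of_subsingleton _) e.surjective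
    (injective_of_subsingleton _)

lemma TorOneVanishes.extension {f : A →ₗ[R] B} {g : B →ₗ[R] C} (hfg : Exact f g)
    (hf : Injective f) (hg : Surjective g) (hA : TorOneVanishes R U A)
    (hC : TorOneVanishes R U C) : TorOneVanishes R U B := by
  have hπ := FreeSyzygy.cover_surjective R B
  obtain ⟨M, _, _, s, j, k, hs, hsex, hj, hjk, hk, hsj, hfk⟩ := exists_kernel_diagram hfg hf
    (FreeSyzygy.incl_injective R B) (FreeSyzygy.exact R B) hπ
  refine TorOneVanishes.of_projective (FreeSyzygy.exact R B) hπ ?_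
  rw [← hsj, LinearMap.lTensor_comp]
  exact (hC _ _ s _ hs hsex (hg.comp hπ)).comp (hA _ _ j k hj hjk hk)

lemma TorOneVanishes.freeSyzygy_rTensor_injective (h : TorOneVanishes R U N) :
    Injective ((FreeSyzygy.incl R U).rTensor N) := by
  rw [← LinearMap.lTensor_inj_iff_rTensor_inj]
  exact h.symm _ _ _ _ (FreeSyzygy.incl_injective R U) (FreeSyzygy.exact R U)
    (FreeSyzygy.cover_surjective R U)

lemma TorOneVanishes.of_freeSyzygy_rTensor_injective
    (h : Injective ((FreeSyzygy.incl R U).rTensor N)) : TorOneVanishes R U N := by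
  rw [← LinearMap.lTensor_inj_iff_rTensor_inj] at h
  exact (TorOneVanishes.of_projective (FreeSyzygy.exact R U)
    (FreeSyzygy.cover_surjective R U) h).symm

/-- Dimension shifting in the first variable against dimension shifting in the second. -/
lemma torOneVanishes_freeSyzygy_iff [Module.Flat R F] {i : M →ₗ[R] F} {g : F →ₗ[R] N}
    (hi : Injective i) (hex : Exact i g) (hg : Surjective g) :
    TorOneVanishes R (FreeSyzygy R U) N ↔ TorOneVanishes R U M := by
  have h1 := Module.Flat.rTensor_preserves_injective_linearMap (M := F) _
    (FreeSyzygy.incl_injective R U)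
  have h2 := Module.Flat.lTensor_preserves_injective_linearMap (M := U →₀ R) _ hi
  have hcomm := (lTensor_rTensor_comm (FreeSyzygy.incl R U) i)
  constructor
  · intro h
    have h4 := h1.comp (h _ _ i g hi hex hg)
    refine TorOneVanishes.of_freeSyzygy_rTensor_injective (Injective.of_comp (f := i.lTensor _) ?_)
    exact hcomm ▸ h4
  · intro h
    have h4 := h2.comp h.freeSyzygy_rTensor_injective
    exact TorOneVanishes.of_exact hex hi hg TorOneVanishes.of_flat_right
      (Injective.of_comp (f := (FreeSyzygy.incl R U).rTensor F) (hcomm ▸ h4))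

/-- The part `Tor₂(U, C) → Tor₁(U, A) → Tor₁(U, B)` of the long exact sequence. -/
lemma TorOneVanishes.of_freeSyzygy {f : A →ₗ[R] B} {g : B →ₗ[R] C} (hfg : Exact f g)
    (hf : Injective f) (hg : Surjective g) (hC : TorOneVanishes R (FreeSyzygy R U) C)
    (hB : TorOneVanishes R U B) : TorOneVanishes R U A := by
  have h3 := hB.freeSyzygy_rTensor_injective.comp (hC _ _ f g hf hfg hg)
  have hcomm := (lTensor_rTensor_comm (FreeSyzygy.incl R U) f)
  refine TorOneVanishes.of_freeSyzygy_rTensor_injective (Injective.of_comp (f := f.lTensor _) ?_)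
  exact hcomm ▸ h3

/-- The part `Tor₂(U, B) → Tor₂(U, C) → Tor₁(U, A)` of the long exact sequence. -/
lemma TorOneVanishes.freeSyzygy_of_exact {f : A →ₗ[R] B} {g : B →ₗ[R] C} (hfg : Exact f g)
    (hf : Injective f) (hg : Surjective g) (hB : TorOneVanishes R (FreeSyzygy R U) B)
    (hA : TorOneVanishes R U A) : TorOneVanishes R (FreeSyzygy R U) C := by
  have h3 := (Module.Flat.lTensor_preserves_injective_linearMap (M := U →₀ R) _ hf).comp
    hA.freeSyzygy_rTensor_injective
  have hcomm := (lTensor_rTensor_comm (FreeSyzygy.incl R U) f)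
  exact TorOneVanishes.of_exact hfg hf hg hB
    (Injective.of_comp (f := (FreeSyzygy.incl R U).rTensor B) (hcomm ▸ h3))

/-- For `A → B → F` exact with `F` projective, the vanishing of `Tor₁(U, coker(B → F))` means that
the sequence stays exact after tensoring with `U`. -/
lemma torOneVanishes_iff_exact [Module.Projective R F] {f : A →ₗ[R] B} {g : B →ₗ[R] F}
    (hfg : Exact f g) :
    TorOneVanishes R U (F ⧸ LinearMap.range g) ↔ Exact (f.lTensor U) (g.lTensor U) := by
  have hr : Exact f g.rangeRestrict := fun x ↦ by
    rw [← hfg x]; exact ⟨fun h ↦ congrArg Subtype.val h, fun h ↦ Subtype.ext h⟩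
  have hrU := lTensor_exact U hr g.surjective_rangeRestrict
  have hcomp (z) : (LinearMap.range g).subtype.lTensor U (g.rangeRestrict.lTensor U z) =
      g.lTensor U z := by
    rw [← LinearMap.comp_apply, ← LinearMap.lTensor_comp]; rfl
  have hq : Exact (LinearMap.range g).subtype (LinearMap.range g).mkQ :=
    LinearMap.exact_subtype_mkQ _
  constructor
  · intro h z
    have hi := h _ _ _ _ (LinearMap.range g).injective_subtype hq (Submodule.mkQ_surjective _)
    rw [← hrU z, ← hcomp]
    exact ⟨fun h0 ↦ hi (h0.trans (map_zero _).symm), fun h0 ↦ by rw [h0, map_zero]⟩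
  · intro h
    refine TorOneVanishes.of_projective hq (Submodule.mkQ_surjective _) ?_
    rw [injective_iff_map_eq_zero]
    intro z hz
    obtain ⟨z, rfl⟩ := LinearMap.lTensor_surjective U g.surjective_rangeRestrict z
    rw [hcomp, h z] at hz
    exact (hrU z).2 hz

end TorOne

section TorSucc

universe u

open TensorProduct Function RingTheory.Sequence
open scoped Pointwise

/-- The vanishing of `Tor_{r+1}(U, N)`, by dimension shifting in the first variable. -/
def TorSuccVanishes (R : Type u) [CommRing R] : ℕ → (U N : Type u) → [AddCommGroup U] →
    [Module R U] → [AddCommGroup N] → [Module R N] → Prop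
  | 0, U, N, _, _, _, _ => TorOneVanishes R U N
  | r + 1, U, N, _, _, _, _ => TorSuccVanishes R r (FreeSyzygy R U) N

variable {R : Type u} [CommRing R]
variable {U N A B C F M : Type u}
  [AddCommGroup U] [Module R U] [AddCommGroup N] [Module R N]
  [AddCommGroup A] [Module R A] [AddCommGroup B] [Module R B] [AddCommGroup C] [Module R C]
  [AddCommGroup F] [Module R F] [AddCommGroup M] [Module R M]

lemma torSuccVanishes_succ_iff [Module.Flat R F] {i : M →ₗ[R] F} {g : F →ₗ[R] N}
    (hi : Injective i) (hex : Exact i g) (hg : Surjective g) (r : ℕ) :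
    TorSuccVanishes R (r + 1) U N ↔ TorSuccVanishes R r U M := by
  induction r generalizing U with
  | zero => exact torOneVanishes_freeSyzygy_iff hi hex hg
  | succ r ih => exact ih (U := FreeSyzygy R U)

lemma TorSuccVanishes.congr (e : M ≃ₗ[R] N) {r : ℕ} (h : TorSuccVanishes R r U M) :
    TorSuccVanishes R r U N := by
  induction r generalizing U with
  | zero => exact TorOneVanishes.congr e h
  | succ r ih => exact ih (U := FreeSyzygy R U) h

lemma TorSuccVanishes.of_flat_right [Module.Flat R N] (r : ℕ) : TorSuccVanishes R r U N := by
  induction r generalizing U with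
  | zero => exact TorOneVanishes.of_flat_right
  | succ r ih => exact ih (U := FreeSyzygy R U)

section SES

variable {f : A →ₗ[R] B} {g : B →ₗ[R] C}

lemma TorSuccVanishes.extension (hfg : Exact f g) (hf : Injective f) (hg : Surjective g) {r : ℕ}
    (hA : TorSuccVanishes R r U A) (hC : TorSuccVanishes R r U C) : TorSuccVanishes R r U B := by
  induction r generalizing U with
  | zero => exact TorOneVanishes.extension hfg hf hg hA hC
  | succ r ih => exact ih (U := FreeSyzygy R U) hA hC

lemma TorSuccVanishes.left_of_exact (hfg : Exact f g) (hf : Injective f) (hg : Surjective g)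
    {r : ℕ} (hC : TorSuccVanishes R (r + 1) U C) (hB : TorSuccVanishes R r U B) :
    TorSuccVanishes R r U A := by
  induction r generalizing U with
  | zero => exact TorOneVanishes.of_freeSyzygy hfg hf hg hC hB
  | succ r ih => exact ih (U := FreeSyzygy R U) hC hB

lemma TorSuccVanishes.right_of_exact (hfg : Exact f g) (hf : Injective f) (hg : Surjective g)
    {r : ℕ} (hB : TorSuccVanishes R (r + 1) U B) (hA : TorSuccVanishes R r U A) :
    TorSuccVanishes R (r + 1) U C := by
  induction r generalizing U with
  | zero => exact TorOneVanishes.freeSyzygy_of_exact hfg hf hg hB hA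
  | succ r ih => exact ih (U := FreeSyzygy R U) hB hA

end SES

lemma QuotSMulTop.exact_lsmul_mkQ (x : R) :
    Exact (LinearMap.lsmul R N x) (Submodule.mkQ (x • (⊤ : Submodule R N))) := by
  intro n
  simp [Submodule.mem_smul_pointwise_iff_exists]

lemma TorSuccVanishes.quotSMulTop {x : R} (hx : IsSMulRegular N x)
    (hxU : IsSMulRegular (U ⊗[R] N) x)
    (hN : ∀ r, TorSuccVanishes R r U N) (r : ℕ) : TorSuccVanishes R r U (QuotSMulTop x N) := by
  have hex := QuotSMulTop.exact_lsmul_mkQ (N := N) x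
  have hs := Submodule.mkQ_surjective (x • (⊤ : Submodule R N))
  cases r with
  | zero =>
    refine TorOneVanishes.of_exact hex hx hs (hN 0) ?_
    have : (LinearMap.lsmul R N x).lTensor U = LinearMap.lsmul R (U ⊗[R] N) x := by
      ext; simp
    rw [this]
    exact hxU
  | succ r => exact TorSuccVanishes.right_of_exact hex hx hs (hN _) (hN _)

lemma TorSuccVanishes.quot_ofList (rs : List R) (hreg : IsWeaklyRegular N rs)
    (hregU : IsWeaklyRegular (U ⊗[R] N) rs) (hN : ∀ r, TorSuccVanishes R r U N) (r : ℕ) :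
    TorSuccVanishes R r U (N ⧸ (Ideal.ofList rs • ⊤ : Submodule R N)) := by
  induction rs generalizing N with
  | nil =>
    refine (hN r).congr (Submodule.quotEquivOfEqBot _ ?_).symm
    simp
  | cons x rs ih =>
    rw [isWeaklyRegular_cons_iff] at hreg hregU
    refine (ih hreg.2 ?_ (TorSuccVanishes.quotSMulTop hreg.1 hregU.1 hN)).congr
      (Submodule.quotOfListConsSMulTopEquivQuotSMulTopInner N x rs).symm
    exact ((QuotSMulTop.tensorQuotSMulTopEquivQuotSMulTop x U N).isWeaklyRegular_congr rs).2
      hregU.2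

section Local

variable [IsLocalRing R]

lemma IsSimpleModule.nonempty_residueField_linearEquiv [IsSimpleModule R N] :
    Nonempty (IsLocalRing.ResidueField R ≃ₗ[R] N) := by
  obtain ⟨I, hI, ⟨e⟩⟩ := isSimpleModule_iff_quot_maximal.mp ‹IsSimpleModule R N›
  obtain rfl := IsLocalRing.eq_maximalIdeal hI
  exact ⟨e.symm⟩

lemma TorSuccVanishes.of_isFiniteLength {r : ℕ}
    (h : TorSuccVanishes R r U (IsLocalRing.ResidueField R)) (hN : IsFiniteLength R N) :
    TorSuccVanishes R r U N := by
  induction hN with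
  | of_subsingleton => exact .of_flat_right r
  | @of_simple_quotient M _ _ S _ _ ih =>
    obtain ⟨e⟩ := IsSimpleModule.nonempty_residueField_linearEquiv (R := R) (N := M ⧸ S)
    exact ih.extension (LinearMap.exact_subtype_mkQ S) S.injective_subtype
      (Submodule.mkQ_surjective S) (h.congr e)

/-- If some nonzero finite length module is `Tor`-independent of `U`, then the vanishing of
`Tor_{r+1}(U, k)` implies that of `Tor₁(U, k)`. -/
lemma TorSuccVanishes.torOneVanishes_residueField [Nontrivial N] (hN : IsFiniteLength R N)
    (hUN : ∀ r, TorSuccVanishes R r U N) {r : ℕ}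
    (h : TorSuccVanishes R r U (IsLocalRing.ResidueField R)) :
    TorOneVanishes R U (IsLocalRing.ResidueField R) := by
  induction r with
  | zero => exact h
  | succ r ih =>
    have := (isFiniteLength_iff_isNoetherian_isArtinian.1 hN).2
    obtain ⟨S, hS⟩ := IsAtomic.exists_atom (Submodule R N)
    have := isSimpleModule_iff_isAtom.2 hS
    obtain ⟨e⟩ := IsSimpleModule.nonempty_residueField_linearEquiv (R := R) (N := S)
    exact ih ((TorSuccVanishes.left_of_exact (LinearMap.exact_subtype_mkQ S) S.injective_subtype
      (Submodule.mkQ_surjective S) (h.of_isFiniteLength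
        (hN.of_surjective (Submodule.mkQ_surjective S))) (hUN r)).congr e.symm)

end Local

end TorSucc

section TorComparison

universe u

open TensorProduct Function

variable {R : Type u} [CommRing R] {U N : Type u} [AddCommGroup U] [Module R U]
  [AddCommGroup N] [Module R N]

lemma torSuccVanishes_of_resolution (P : ℕ → Type u) [∀ n, AddCommGroup (P n)]
    [∀ n, Module R (P n)] [∀ n, Module.Projective R (P n)] (d : ∀ n, P (n + 1) →ₗ[R] P n)
    (hd : ∀ n, Exact (d (n + 1)) (d n)) {ε : P 0 →ₗ[R] N} (hε : Surjective ε)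
    (hdε : Exact (d 0) ε) (j : ℕ)
    (h : Exact ((d (j + 1)).lTensor U) ((d j).lTensor U)) : TorSuccVanishes R j U N := by
  have key (i r : ℕ) (h : TorSuccVanishes R r U (P i ⧸ LinearMap.range (d i))) :
      TorSuccVanishes R (r + i) U (P 0 ⧸ LinearMap.range (d 0)) := by
    induction i generalizing r with
    | zero => exact h
    | succ i ih =>
      have hker : LinearMap.range (d (i + 1)) = LinearMap.ker (d i) := (hd i).linearMap_ker_eq.symm
      rw [show r + (i + 1) = (r + 1) + i by ring]
      refine ih (r + 1) ((torSuccVanishes_succ_iff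
        (i := (LinearMap.range (d (i + 1))).liftQ (d i) hker.le)
        (g := (LinearMap.range (d i)).mkQ) ?_ ?_ (Submodule.mkQ_surjective _) r).2 h)
      · rw [← LinearMap.ker_eq_bot, Submodule.ker_liftQ_eq_bot _ _ _ hker.ge]
      · rw [LinearMap.exact_iff, Submodule.ker_mkQ, Submodule.range_liftQ]
  have h0 : TorSuccVanishes R 0 U (P j ⧸ LinearMap.range (d j)) :=
    (torOneVanishes_iff_exact (hd j)).2 h
  have := key j 0 h0
  rw [zero_add] at this
  exact this.congr ((Submodule.quotEquivOfEq _ _ hdε.linearMap_ker_eq.symm).trans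
    (ε.quotKerEquivOfSurjective hε))

lemma torSuccVanishes_of_subsingleton_tor (j : ℕ)
    (h : Subsingleton (((Tor (ModuleCat R) (j + 1)).obj (ModuleCat.of R U)).obj
      (ModuleCat.of R N))) : TorSuccVanishes R j U N := by
  let P := projectiveResolution (ModuleCat.of R N)
  have (n : ℕ) : Module.Projective R (P.complex.X n) :=
    (IsProjective.iff_projective _).2 (P.projective n)
  refine torSuccVanishes_of_resolution (fun n ↦ P.complex.X n)
    (fun n ↦ (P.complex.d (n + 1) n).hom) (fun n ↦ ?_) (ε := (P.π.f 0).hom) ?_ ?_ j ?_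
  · exact (ShortComplex.ShortExact.moduleCat_exact_iff_function_exact _).1 (P.exact_succ n)
  · exact (ModuleCat.epi_iff_surjective _).1 inferInstance
  · exact (ShortComplex.ShortExact.moduleCat_exact_iff_function_exact _).1 P.exact₀
  · let F := (MonoidalCategory.tensoringLeft (ModuleCat R)).obj (ModuleCat.of R U)
    have : Subsingleton ((F.leftDerived (j + 1)).obj (ModuleCat.of R N)) := h
    have hz : Limits.IsZero (((F.mapHomologicalComplex _).obj P.complex).homology (j + 1)) :=
      (ModuleCat.isZero_of_subsingleton _).of_iso (P.isoLeftDerivedObj F (j + 1)).symm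
    rw [← HomologicalComplex.exactAt_iff_isZero_homology,
      HomologicalComplex.exactAt_iff' _ (j + 1 + 1) (j + 1) j (by simp) (by simp)] at hz
    exact (ShortComplex.ShortExact.moduleCat_exact_iff_function_exact _).1 hz

end TorComparison

section FinitePresentation

universe u

open TensorProduct Function

variable {R : Type u} [CommRing R]

/-- The map `U^m → U^n` induced by a linear map `R^m → R^n`. -/
def LinearMap.piExtend (U : Type u) [AddCommGroup U] [Module R U] {m n : ℕ}
    (α : (Fin m → R) →ₗ[R] (Fin n → R)) : (Fin m → U) →ₗ[R] (Fin n → U) :=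
  LinearMap.pi fun i ↦ ∑ k, α (Pi.single k 1) i • LinearMap.proj k

lemma LinearMap.piExtend_apply {U : Type u} [AddCommGroup U] [Module R U] {m n : ℕ}
    (α : (Fin m → R) →ₗ[R] (Fin n → R)) (v : Fin m → U) (i : Fin n) :
    α.piExtend U v i = ∑ k, α (Pi.single k 1) i • v k := by
  simp [piExtend]

lemma LinearMap.piExtend_self {m n : ℕ} (α : (Fin m → R) →ₗ[R] (Fin n → R)) (v : Fin m → R) :
    α.piExtend R v = α v := by
  have hk (k : Fin m) : (Pi.single k 1 : Fin m → R) = fun j ↦ if k = j then 1 else 0 := by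
    ext j; simp [Pi.single_apply, eq_comm]
  ext i
  rw [LinearMap.pi_apply_eq_sum_univ α v, piExtend_apply]
  simp [hk, mul_comm]

lemma LinearMap.piExtend_piExtend {U : Type u} [AddCommGroup U] [Module R U] {l m n : ℕ}
    (α : (Fin l → R) →ₗ[R] (Fin m → R)) (β : (Fin m → R) →ₗ[R] (Fin n → R)) (v : Fin l → U) :
    β.piExtend U (α.piExtend U v) = (β ∘ₗ α).piExtend U v := by
  ext i
  have (k : Fin l) : β (α (Pi.single k 1)) i = ∑ a, β (Pi.single a 1) i * α (Pi.single k 1) a := by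
    rw [← piExtend_self β, piExtend_apply]; rfl
  simp only [piExtend_apply, Finset.smul_sum, smul_smul, comp_apply, this, Finset.sum_smul]
  exact Finset.sum_comm

lemma LinearMap.piExtend_comp {U V : Type u} [AddCommGroup U] [Module R U] [AddCommGroup V]
    [Module R V] {m n : ℕ} (α : (Fin m → R) →ₗ[R] (Fin n → R)) (φ : U →ₗ[R] V) (v : Fin m → U) :
    α.piExtend V (φ ∘ v) = φ ∘ α.piExtend U v := by
  ext i
  simp [piExtend_apply]

lemma exact_lTensor_iff_exact_piExtend (U : Type u) [AddCommGroup U] [Module R U] {l m n : ℕ}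
    (α : (Fin l → R) →ₗ[R] (Fin m → R)) (β : (Fin m → R) →ₗ[R] (Fin n → R)) :
    Exact (α.lTensor U) (β.lTensor U) ↔ Exact (α.piExtend U) (β.piExtend U) := by
  have key {m n : ℕ} (α : (Fin m → R) →ₗ[R] (Fin n → R)) :
      α.piExtend U ∘ₗ (TensorProduct.piScalarRight R R U (Fin m)).toLinearMap =
        (TensorProduct.piScalarRight R R U (Fin n)).toLinearMap ∘ₗ α.lTensor U := by
    ext u k i
    simp [LinearMap.piExtend_apply, Pi.single_apply]
  exact (Exact.iff_of_ladder_linearEquiv (key α) (key β)).symm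

/-- Exactness of a complex of finite free modules passes from an algebra to any localization of a
power of it. -/
lemma exact_piExtend_localization {ι S W : Type u} [CommRing S] [CommRing W] [Algebra R S]
    [Algebra R W] [Algebra (ι → S) W] [IsScalarTower R (ι → S) W] (M : Submonoid (ι → S))
    [IsLocalization M W] {l m n : ℕ}
    {α : (Fin l → R) →ₗ[R] (Fin m → R)} {β : (Fin m → R) →ₗ[R] (Fin n → R)}
    (h : Exact (α.piExtend S) (β.piExtend S)) (h0 : β ∘ₗ α = 0) :
    Exact (α.piExtend W) (β.piExtend W) := by
  intro w
  constructor
  · intro hw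
    obtain ⟨c, hc⟩ := IsLocalization.exist_integer_multiples_of_finite M w
    choose v hv using hc
    let φ : (ι → S) →ₗ[R] W := (IsScalarTower.toAlgHom R (ι → S) W).toLinearMap
    have hv' : φ ∘ v = fun i ↦ algebraMap (ι → S) W c * w i := funext fun i ↦ by
      rw [← Algebra.smul_def]; exact hv i
    have h1 : φ ∘ β.piExtend (ι → S) v = 0 := by
      rw [← LinearMap.piExtend_comp, hv']
      ext i
      have := congrFun hw i
      simp only [LinearMap.piExtend_apply, ← mul_smul_comm, ← Finset.mul_sum] at this ⊢
      rw [this, Pi.zero_apply, mul_zero]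
    have h2 (i) : ∃ c : M, (c : ι → S) * β.piExtend (ι → S) v i = 0 :=
      (IsLocalization.map_eq_zero_iff M W _).1 (congrFun h1 i)
    choose b hb using h2
    let b' : M := ∏ i, b i
    have h3 (N : ι) : β.piExtend S (fun i ↦ (b' : ι → S) N * v i N) = 0 := by
      ext i
      have : (b' : ι → S) * β.piExtend (ι → S) v i = 0 := by
        obtain ⟨d, hd⟩ : b i ∣ b' := Finset.dvd_prod_of_mem b (Finset.mem_univ i)
        rw [hd, mul_comm (b i), Submonoid.coe_mul, mul_assoc, hb, mul_zero]
      have := congrFun this N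
      simpa [LinearMap.piExtend_apply, Finset.mul_sum] using this
    have h4 (N : ι) := (h _).1 (h3 N)
    choose t ht using h4
    have h5 : α.piExtend (ι → S) (fun i N ↦ t N i) = fun i ↦ (b' : ι → S) * v i := by
      ext i N
      simpa [LinearMap.piExtend_apply] using congrFun (ht N) i
    have h6 : α.piExtend W (φ ∘ fun i N ↦ t N i) = fun i ↦ algebraMap (ι → S) W (b' * c) * w i := by
      rw [LinearMap.piExtend_comp, h5]
      ext i
      rw [map_mul, mul_assoc, ← congrFun hv' i]
      exact map_mul (algebraMap (ι → S) W) _ _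
    obtain ⟨d, hd⟩ := IsLocalization.map_units W (b' * c)
    refine ⟨fun i ↦ ↑d⁻¹ * φ (fun N ↦ t N i), ?_⟩
    ext i
    have := congrFun h6 i
    simp only [LinearMap.piExtend_apply, ← mul_smul_comm, ← Finset.mul_sum] at this ⊢
    erw [this, ← Submonoid.coe_mul, ← hd, Units.inv_mul_cancel_left]
  · rintro ⟨v, rfl⟩
    rw [LinearMap.piExtend_piExtend, h0]
    ext i
    simp [LinearMap.piExtend_apply]

lemma TorOneVanishes.localization [IsNoetherianRing R]
    {ι S W : Type u} [CommRing S] [CommRing W] [Algebra R S]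
    [Algebra R W] [Algebra (ι → S) W] [IsScalarTower R (ι → S) W] (M : Submonoid (ι → S))
    [IsLocalization M W] {N : Type u} [AddCommGroup N] [Module R N] [Module.Finite R N]
    (h : TorOneVanishes R S N) : TorOneVanishes R W N := by
  obtain ⟨n, π, hπ⟩ := Module.Finite.exists_fin' R N
  obtain ⟨m, β', hβ'⟩ := Module.Finite.exists_fin' R (LinearMap.ker π)
  let β := (LinearMap.ker π).subtype ∘ₗ β'
  obtain ⟨l, α', hα'⟩ := Module.Finite.exists_fin' R (LinearMap.ker β)
  let α := (LinearMap.ker β).subtype ∘ₗ α'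
  have hαβ : Exact α β := by
    rw [LinearMap.exact_iff, LinearMap.range_comp, LinearMap.range_eq_top.2 hα',
      Submodule.map_top, Submodule.range_subtype]
  have hβ : LinearMap.range β = LinearMap.ker π := by
    rw [LinearMap.range_comp, LinearMap.range_eq_top.2 hβ', Submodule.map_top,
      Submodule.range_subtype]
  let e : ((Fin n → R) ⧸ LinearMap.range β) ≃ₗ[R] N :=
    (Submodule.quotEquivOfEq _ _ hβ).trans (π.quotKerEquivOfSurjective hπ)
  refine TorOneVanishes.congr e ((torOneVanishes_iff_exact hαβ).2 ?_)
  have h1 := (torOneVanishes_iff_exact hαβ).1 (h.congr e.symm)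
  rw [exact_lTensor_iff_exact_piExtend] at h1 ⊢
  exact exact_piExtend_localization M h1 hαβ.linearMap_comp_eq_zero

lemma TorSuccVanishes.localization [IsNoetherianRing R]
    {ι S W : Type u} [CommRing S] [CommRing W] [Algebra R S]
    [Algebra R W] [Algebra (ι → S) W] [IsScalarTower R (ι → S) W] (M : Submonoid (ι → S))
    [IsLocalization M W] {N : Type u} [AddCommGroup N] [Module R N] [Module.Finite R N] {r : ℕ}
    (h : TorSuccVanishes R r S N) : TorSuccVanishes R r W N := by
  induction r generalizing N with
  | zero => exact TorOneVanishes.localization M h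
  | succ r ih =>
    obtain ⟨n, π, hπ⟩ := Module.Finite.exists_fin' R N
    have hex := LinearMap.exact_subtype_ker_map π
    have hi := (LinearMap.ker π).injective_subtype
    exact (torSuccVanishes_succ_iff hi hex hπ r).2
      (ih ((torSuccVanishes_succ_iff hi hex hπ r).1 h))

end FinitePresentation

section DominatingValuation

open IsLocalRing

lemma exists_valuationSubring_of_isPrime {K : Type*} [Field K] (A : Subring K) (P : Ideal A)
    [P.IsPrime] : ∃ V : ValuationSubring K, A ≤ V.toSubring ∧
      (∀ a : A, a ∈ P → V.valuation a < 1) ∧ ∀ a : A, a ∉ P → V.valuation a = 1 := by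
  obtain ⟨V, h, hloc⟩ := (LocalSubring.ofPrime A P).exists_le_valuationSubring
  have hle := (LocalSubring.le_ofPrime A P).trans h
  have hunit (a : A) : a ∉ P ↔ V.valuation a = 1 := by
    have h1 := IsLocalization.AtPrime.isUnit_to_map_iff (LocalSubring.ofPrime A P).toSubring P a
    rw [← isUnit_map_iff (Subring.inclusion h)] at h1
    exact h1.symm.trans (V.valuation_eq_one_iff ⟨a, hle a.2⟩)
  refine ⟨V, hle, fun a ha ↦ lt_of_le_of_ne ((V.valuation_le_one_iff _).2 (hle a.2)) ?_,
    fun a ↦ (hunit a).1⟩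
  exact fun h ↦ (hunit a).2 h ha

variable {R : Type*} [CommRing R] [IsNoetherianRing R] [IsLocalRing R]

lemma Ideal.sup_pow_le_pow_succ {A : Type*} [CommRing A] {I J M : Ideal A} (hI : I ≤ M)
    (hJ : J ≤ M) {k l : ℕ} (hIk : I ^ k ≤ M ^ (k + 1)) (hJl : J ^ l ≤ M ^ (l + 1)) :
    (I ⊔ J) ^ (k + l) ≤ M ^ (k + l + 1) := by
  rw [← Ideal.add_eq_sup, add_pow, Ideal.sum_eq_sup]
  refine Finset.sup_le fun m hm ↦ Ideal.mul_le_left.trans ?_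
  obtain hkm | hkm := le_total k m
  · obtain ⟨d, rfl⟩ := Nat.exists_eq_add_of_le hkm
    have hm' : k + d ≤ k + l := Nat.lt_succ_iff.1 (Finset.mem_range.1 hm)
    rw [pow_add I, show k + l + 1 = (k + 1) + d + (k + l - (k + d)) by omega, pow_add M, pow_add M]
    gcongr
  · obtain ⟨d, hd⟩ : ∃ d, k + l - m = l + d := ⟨k - m, by omega⟩
    rw [hd, show k + l + 1 = m + ((l + 1) + d) by omega, pow_add J,
      pow_add M, pow_add M (l + 1)]
    gcongr

lemma exists_pow_notMem_maximalIdeal_pow_succ [IsDomain R] (hR : ¬ IsField R) :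
    ∃ y ∈ maximalIdeal R, ∀ k, y ^ k ∉ maximalIdeal R ^ (k + 1) := by
  classical
  by_contra! hcon
  have key (s : Finset R) : Ideal.span (s : Set R) ≤ maximalIdeal R →
      ∃ k, Ideal.span (s : Set R) ^ k ≤ maximalIdeal R ^ (k + 1) := by
    induction s using Finset.induction with
    | empty => exact fun _ ↦ ⟨1, by simp⟩
    | insert a s _ ih =>
      rw [Finset.coe_insert, Ideal.span_insert]
      intro h
      obtain ⟨ha, hs⟩ := sup_le_iff.1 h
      obtain ⟨l, hl⟩ := ih hs
      obtain ⟨k, hk⟩ := hcon a (ha (Ideal.mem_span_singleton_self a))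
      refine ⟨k + l, Ideal.sup_pow_le_pow_succ ha hs ?_ hl⟩
      rwa [Ideal.span_singleton_pow, Ideal.span_singleton_le_iff_mem]
  obtain ⟨s, hs⟩ := IsNoetherian.noetherian (maximalIdeal R)
  obtain ⟨k, hk⟩ := key s hs.le
  rw [show Ideal.span (s : Set R) = maximalIdeal R from hs] at hk
  have h0 : maximalIdeal R ^ k = ⊥ := Submodule.eq_bot_of_le_smul_of_le_jacobson_bot
    (maximalIdeal R) _ (IsNoetherian.noetherian _) (by rwa [smul_eq_mul, ← pow_succ'])
    (IsLocalRing.maximalIdeal_le_jacobson _)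
  refine hR (IsLocalRing.isField_iff_maximalIdeal_eq.2 ?_)
  exact eq_zero_of_pow_eq_zero h0

lemma mul_pow_mem_of_height_le_one {A : Type*} [CommRing A] [IsDomain A] {P : Ideal A} [P.IsPrime]
    (hP : P.height ≤ 1) {y c : A} (hy : y ∈ P) (hc : c ≠ 0) :
    ∃ u ∉ P, ∃ N b, u * y ^ N = c * b := by
  by_contra! hcon
  have hdisj : Disjoint (Ideal.span {c} : Set A)
      (P.primeCompl ⊔ Submonoid.powers y : Submonoid A) := by
    rw [Set.disjoint_left]
    intro a ha ha'
    obtain ⟨u, hu, _, ⟨N, rfl⟩, rfl⟩ := Submonoid.mem_sup.1 ha'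
    obtain ⟨b, hb⟩ := Ideal.mem_span_singleton.1 ha
    exact hcon u hu N b hb
  obtain ⟨Q, hQ, hcQ, hQd⟩ := Ideal.exists_le_prime_disjoint _ _ hdisj
  rw [Set.disjoint_left] at hQd
  have hQP : Q ≤ P := fun a ha ↦ by
    by_contra haP
    exact hQd ha (Submonoid.mem_sup_left haP)
  have hQ0 : ⊥ < Q := bot_lt_iff_ne_bot.2 fun h ↦ hc (by
    simpa [h] using hcQ (Ideal.mem_span_singleton_self c))
  have hyQ : y ∉ Q := fun h ↦ hQd h (Submonoid.mem_sup_right (Submonoid.mem_powers y))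
  have hlt : Q < P := lt_of_le_of_ne hQP fun h ↦ hyQ (h ▸ hy)
  have h1 := Ideal.height_add_one_le_of_lt_of_isPrime hQ0
  have h2 := Ideal.height_add_one_le_of_lt_of_isPrime hlt
  have h3 : (⊥ : Ideal A).height + 1 + 1 ≤ 1 := (by gcongr : _ ≤ Q.height + 1).trans (h2.trans hP)
  rw [Ideal.height_bot] at h3
  norm_num at h3

/-- A Noetherian local domain is dominated by a valuation ring in which `𝔪` becomes principal and
whose valuation is archimedean on `R`. -/
lemma exists_dominating_valuationSubring [IsDomain R] (hR : ¬ IsField R) (K : Type*) [Field K]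
    [Algebra R K] [FaithfulSMul R K] :
    ∃ (V : ValuationSubring K) (y : R), (∀ z, V.valuation (algebraMap R K z) ≤ 1) ∧ y ≠ 0 ∧
      V.valuation (algebraMap R K y) < 1 ∧
      (∀ z ∈ maximalIdeal R, V.valuation (algebraMap R K z) ≤ V.valuation (algebraMap R K y)) ∧
      ∀ c : R, c ≠ 0 → ∃ N,
        V.valuation (algebraMap R K y) ^ N ≤ V.valuation (algebraMap R K c) := by
  classical
  obtain ⟨y, hy, hyk⟩ := exists_pow_notMem_maximalIdeal_pow_succ hR
  have hinj := FaithfulSMul.algebraMap_injective R K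
  have hy0 : y ≠ 0 := fun h ↦ hyk 1 (by simp [h])
  have hy0' : algebraMap R K y ≠ 0 := by simpa using hy0
  obtain ⟨s, hs⟩ := IsNoetherian.noetherian (maximalIdeal R)
  let A : Subalgebra R K :=
    Algebra.adjoin R (s.image fun a ↦ algebraMap R K a / algebraMap R K y : Finset K)
  have : IsNoetherianRing A := isNoetherianRing_of_fg ⟨_, rfl⟩
  have hdiv (z) (hz : z ∈ maximalIdeal R) : algebraMap R K z / algebraMap R K y ∈ A := by
    rw [← hs] at hz
    induction hz using Submodule.span_induction with
    | mem z hz => exact Algebra.subset_adjoin (by simpa using ⟨z, hz, rfl⟩)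
    | zero => simp
    | add a b _ _ ha hb => rw [map_add, add_div]; exact add_mem ha hb
    | smul r a _ ha =>
      rw [smul_eq_mul, map_mul, mul_div_assoc]
      exact mul_mem (A.algebraMap_mem r) ha
  have hpow (b : K) (hb : b ∈ A) :
      ∃ k, ∃ r ∈ maximalIdeal R ^ k, b * algebraMap R K y ^ k = algebraMap R K r := by
    induction hb using Algebra.adjoin_induction with
    | mem b hb =>
      obtain ⟨a, ha, rfl⟩ := Finset.mem_image.1 (Finset.mem_coe.1 hb)
      refine ⟨1, a, ?_, by simp [hy0']⟩
      rw [pow_one, ← hs]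
      exact Submodule.subset_span ha
    | algebraMap r => exact ⟨0, r, by simp, by simp⟩
    | add a b _ _ ha hb =>
      obtain ⟨k, r, hr, h1⟩ := ha
      obtain ⟨l, t, ht, h2⟩ := hb
      refine ⟨k + l, r * y ^ l + y ^ k * t, add_mem ?_ ?_, ?_⟩
      · rw [pow_add]; exact Ideal.mul_mem_mul hr (Ideal.pow_mem_pow hy l)
      · rw [pow_add]; exact Ideal.mul_mem_mul (Ideal.pow_mem_pow hy k) ht
      · rw [map_add, map_mul, map_mul, ← h1, ← h2, map_pow, map_pow]; ring
    | mul a b _ _ ha hb =>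
      obtain ⟨k, r, hr, h1⟩ := ha
      obtain ⟨l, t, ht, h2⟩ := hb
      refine ⟨k + l, r * t, ?_, ?_⟩
      · rw [pow_add]; exact Ideal.mul_mem_mul hr ht
      · rw [map_mul, ← h1, ← h2]; ring
  have htop : Ideal.span {algebraMap R A y} ≠ ⊤ := by
    rw [Ne, Ideal.span_singleton_eq_top]
    intro hu
    obtain ⟨⟨b, hb⟩, hb1⟩ := hu.exists_right_inv
    obtain ⟨k, r, hr, h⟩ := hpow b hb
    refine hyk k ?_
    have hb2 : algebraMap R K y * b = 1 := congrArg Subtype.val hb1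
    have : y ^ k = y * r := hinj (by
      rw [map_mul, ← h, map_pow, ← mul_assoc, hb2, one_mul])
    rw [this, pow_succ']
    exact Ideal.mul_mem_mul hy hr
  obtain ⟨P, hP⟩ := Ideal.nonempty_minimalPrimes htop
  have := hP.isPrime
  have hyP : algebraMap R A y ∈ P := hP.1.2 (Ideal.mem_span_singleton_self _)
  have hht := Ideal.height_le_one_of_isPrincipal_of_mem_minimalPrimes _ P hP
  obtain ⟨V, hAV, hVP, hVu⟩ := exists_valuationSubring_of_isPrime A.toSubring P
  have hA1 (a : A) : V.valuation (a : K) ≤ 1 := (V.valuation_le_one_iff _).2 (hAV a.2)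
  refine ⟨V, y, fun z ↦ hA1 (algebraMap R A z), hy0, hVP _ hyP, fun z hz ↦ ?_, fun c hc ↦ ?_⟩
  · have := hA1 ⟨_, hdiv z hz⟩
    rw [map_div₀] at this
    exact (div_le_one₀ (by simpa [zero_lt_iff] using hy0)).1 this
  · obtain ⟨u, hu, N, b, h⟩ := mul_pow_mem_of_height_le_one hht hyP (c := algebraMap R A c)
      (by simpa using hc)
    refine ⟨N, ?_⟩
    have h' : (u : K) * algebraMap R K y ^ N = algebraMap R K c * b := congrArg Subtype.val h
    have h2 := congrArg V.valuation h'
    rw [map_mul, map_mul, hVu u hu, one_mul, map_pow] at h2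
    rw [h2]
    exact mul_le_of_le_one_right' (hA1 b)

end DominatingValuation

section WeaklyRegularPow

open RingTheory.Sequence Function
open scoped Pointwise

variable {R : Type*} [CommRing R]

/-- Weak regularity passes to the middle term of a short exact sequence. -/
lemma RingTheory.Sequence.IsWeaklyRegular.of_exact {A B C : Type*} [AddCommGroup A] [Module R A]
    [AddCommGroup B] [Module R B] [AddCommGroup C] [Module R C] {rs : List R}
    {f : A →ₗ[R] B} {g : B →ₗ[R] C} (hf : Injective f) (hfg : Exact f g) (hg : Surjective g)
    (hA : IsWeaklyRegular A rs) (hC : IsWeaklyRegular C rs) : IsWeaklyRegular B rs := by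
  induction rs generalizing A B C with
  | nil => exact .nil R B
  | cons r rs ih =>
    rw [isWeaklyRegular_cons_iff] at hA hC ⊢
    refine ⟨isSMulRegular_of_range_eq_ker hf hfg.linearMap_ker_eq.symm hA.1 hC.1,
      ih (f := QuotSMulTop.map r f) (g := QuotSMulTop.map r g) ?_
        (QuotSMulTop.map_exact r hfg hg) (QuotSMulTop.map_surjective r hg) hA.2 hC.2⟩
    have h0 : Exact (0 : PUnit →ₗ[R] A) f := by
      rw [LinearMap.exact_zero_iff_injective]; exact hf
    have := QuotSMulTop.map_first_exact_on_four_term_exact_of_isSMulRegular_last h0 hfg hC.1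
    rw [map_zero] at this
    exact (LinearMap.exact_zero_iff_injective _ _).mp this

/-- Multiplication by `x` gives a right exact sequence `M/xᵃM → M/xᵃ⁺¹M → M/xM → 0`. -/
lemma QuotSMulTop.exists_exact_pow {M : Type*} [AddCommGroup M] [Module R M] (x : R) (a : ℕ) :
    ∃ (f : QuotSMulTop (x ^ a) M →ₗ[R] QuotSMulTop (x ^ (a + 1)) M)
      (g : QuotSMulTop (x ^ (a + 1)) M →ₗ[R] QuotSMulTop x M),
      Exact f g ∧ Surjective g ∧ (IsSMulRegular M x → Injective f) := by
  have h1 : (x ^ a • ⊤ : Submodule R M) ≤ Submodule.comap (LinearMap.lsmul R M x)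
      (x ^ (a + 1) • ⊤ : Submodule R M) := by
    intro m hm
    obtain ⟨n, -, rfl⟩ := (Submodule.mem_smul_pointwise_iff_exists _ _ _).mp hm
    exact (Submodule.mem_smul_pointwise_iff_exists _ _ _).mpr
      ⟨n, trivial, by rw [LinearMap.lsmul_apply, smul_smul, pow_succ']⟩
  have h2 : (x ^ (a + 1) • ⊤ : Submodule R M) ≤ Submodule.comap LinearMap.id
      (x • ⊤ : Submodule R M) := by
    intro m hm
    obtain ⟨n, -, rfl⟩ := (Submodule.mem_smul_pointwise_iff_exists _ _ _).mp hm
    exact (Submodule.mem_smul_pointwise_iff_exists _ _ _).mpr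
      ⟨x ^ a • n, trivial, by simp [smul_smul, pow_succ']⟩
  refine ⟨Submodule.mapQ _ _ _ h1, Submodule.mapQ _ _ _ h2, fun m ↦ ?_, fun m ↦ ?_, fun hx ↦ ?_⟩
  · obtain ⟨m, rfl⟩ := Submodule.Quotient.mk_surjective _ m
    rw [Submodule.mapQ_apply, Submodule.Quotient.mk_eq_zero]
    constructor
    · intro hm
      obtain ⟨n, -, hn⟩ := (Submodule.mem_smul_pointwise_iff_exists _ _ _).mp hm
      exact ⟨Submodule.Quotient.mk n, congrArg _ hn⟩
    · rintro ⟨n, hn⟩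
      obtain ⟨n, rfl⟩ := Submodule.Quotient.mk_surjective _ n
      rw [Submodule.mapQ_apply, Submodule.Quotient.eq] at hn
      have h3 := sub_mem (Submodule.smul_mem_pointwise_smul n x ⊤ trivial) (h2 hn)
      simpa using h3
  · obtain ⟨m, rfl⟩ := Submodule.Quotient.mk_surjective _ m
    exact ⟨Submodule.Quotient.mk m, rfl⟩
  · rw [injective_iff_map_eq_zero]
    intro m hm
    obtain ⟨m, rfl⟩ := Submodule.Quotient.mk_surjective _ m
    rw [Submodule.mapQ_apply, Submodule.Quotient.mk_eq_zero] at hm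
    obtain ⟨n, -, hn⟩ := (Submodule.mem_smul_pointwise_iff_exists _ _ _).mp hm
    rw [LinearMap.lsmul_apply, pow_succ', mul_smul] at hn
    rw [Submodule.Quotient.mk_eq_zero, ← hx hn]
    exact Submodule.smul_mem_pointwise_smul _ _ _ trivial

instance QuotSMulTop.subsingleton_pow_zero {M : Type*} [AddCommGroup M] [Module R M] (x : R) :
    Subsingleton (QuotSMulTop (x ^ 0) M) := by
  rw [Submodule.Quotient.subsingleton_iff, pow_zero, one_smul]

lemma RingTheory.Sequence.IsWeaklyRegular.quotSMulTop_pow {M : Type*} [AddCommGroup M]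
    [Module R M] {x : R} {rs : List R} (hx : IsSMulRegular M x)
    (h : IsWeaklyRegular (QuotSMulTop x M) rs) (a : ℕ) :
    IsWeaklyRegular (QuotSMulTop (x ^ a) M) rs := by
  induction a with
  | zero => exact ⟨fun i hi ↦ Function.injective_of_subsingleton _⟩
  | succ a ih =>
    obtain ⟨f, g, hfg, hg, hf⟩ := QuotSMulTop.exists_exact_pow (M := M) x a
    exact .of_exact (hf hx) hfg hg ih h

/-- Replacing the elements of a weakly regular sequence by powers gives a weakly regular
sequence. -/
lemma RingTheory.Sequence.IsWeaklyRegular.map_pow {M : Type*} [AddCommGroup M] [Module R M]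
    {rs : List R} (h : IsWeaklyRegular M rs) (q : ℕ) :
    IsWeaklyRegular M (rs.map (· ^ q)) := by
  induction rs generalizing M with
  | nil => exact .nil R M
  | cons r rs ih =>
    rw [isWeaklyRegular_cons_iff] at h
    rw [List.map_cons, isWeaklyRegular_cons_iff]
    exact ⟨h.1.pow q, ih (.quotSMulTop_pow h.1 h.2 q)⟩

end WeaklyRegularPow

section FreeComparison

/-- Up to multiplication by a nonzero element, a finite module over a domain maps isomorphically
onto a free module. -/
lemma Module.Finite.exists_comp_eq_smul (R M : Type*) [CommRing R] [IsDomain R] [AddCommGroup M]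
    [Module R M] [Module.Finite R M] :
    ∃ (ι : Type) (_ : Finite ι) (ψ : M →ₗ[R] (ι →₀ R)) (θ : (ι →₀ R) →ₗ[R] M) (c : R),
      c ≠ 0 ∧ ∀ m, θ (ψ m) = c • m := by
  obtain ⟨n, v, hv⟩ := Module.Finite.exists_fin (R := R) (M := M)
  obtain ⟨s, hs, hmax⟩ := exists_maximal_linearIndepOn R v
  have hs' : LinearIndependent R fun i : s ↦ v i := hs
  have key (i : Fin n) : ∃ a : R, a ≠ 0 ∧ a • v i ∈ Submodule.span R (v '' s) := by
    by_cases hi : i ∈ s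
    · exact ⟨1, one_ne_zero, by
        rw [one_smul]; exact Submodule.subset_span (Set.mem_image_of_mem v hi)⟩
    · exact hmax i hi
  choose a ha0 ha using key
  let θ := Finsupp.linearCombination R fun i : s ↦ v i
  have hrange : LinearMap.range θ = Submodule.span R (v '' s) := by
    rw [Finsupp.range_linearCombination, Set.image_eq_range]
  have hc (m : M) : (∏ i, a i) • m ∈ LinearMap.range θ := by
    have : (⊤ : Submodule R M) ≤
        (LinearMap.range θ).comap (LinearMap.lsmul R M (∏ i, a i)) := by
      rw [← hv, Submodule.span_le]
      rintro _ ⟨i, rfl⟩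
      rw [SetLike.mem_coe, Submodule.mem_comap, LinearMap.lsmul_apply, hrange,
        ← Finset.prod_erase_mul _ _ (Finset.mem_univ i), mul_smul]
      exact Submodule.smul_mem _ _ (ha i)
    exact this trivial
  let e := LinearEquiv.ofInjective θ hs'
  refine ⟨s, inferInstance, e.symm.toLinearMap ∘ₗ
    (LinearMap.lsmul R M (∏ i, a i)).codRestrict (LinearMap.range θ) hc, θ, ∏ i, a i,
    Finset.prod_ne_zero_iff.mpr fun i _ ↦ ha0 i, fun m ↦ ?_⟩
  exact congrArg Subtype.val (e.apply_symm_apply ⟨_, hc m⟩)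

end FreeComparison

section TailLocalization

open RingTheory.Sequence Filter

lemma Submodule.mem_span_range_smul_top_iff {ι R M : Type*} [Fintype ι] [CommRing R]
    [AddCommGroup M] [Module R M] (v : ι → R) (z : M) :
    z ∈ Ideal.span (Set.range v) • (⊤ : Submodule R M) ↔ ∃ c : ι → M, ∑ i, v i • c i = z := by
  constructor
  · intro hz
    induction hz using Submodule.smul_induction_on' with
    | smul r hr m hm =>
      obtain ⟨a, rfl⟩ := Ideal.mem_span_range_iff_exists_fun.mp hr
      exact ⟨fun i ↦ a i • m, by simp [Finset.sum_smul, mul_smul, smul_comm (v _)]⟩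
    | add x hx y hy h1 h2 =>
      obtain ⟨c, rfl⟩ := h1
      obtain ⟨d, rfl⟩ := h2
      exact ⟨c + d, by simp [Finset.sum_add_distrib]⟩
  · rintro ⟨c, rfl⟩
    exact sum_mem fun i _ ↦ Submodule.smul_mem_smul (Ideal.subset_span ⟨i, rfl⟩) trivial

lemma Ideal.ofList_eq_span_range_get {R : Type*} [CommRing R] (l : List R) :
    Ideal.ofList l = Ideal.span (Set.range l.get) := by
  rw [Set.range_list_get]

lemma Ideal.ofList_map_eq_span_range_get {R : Type*} [CommRing R] (f : R → R) (l : List R) :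
    Ideal.ofList (l.map f) = Ideal.span (Set.range fun i ↦ f (l.get i)) := by
  have : Set.range (fun i ↦ f (l.get i)) = f '' {r | r ∈ l} := by
    rw [← Set.range_list_get, ← Set.range_comp]
    rfl
  rw [this]
  exact congrArg Ideal.span (Set.ext fun z ↦ by simp)

/-- The mixed form of the defining property of a weakly regular sequence. -/
lemma RingTheory.Sequence.IsWeaklyRegular.mem_of_smul_mem {R M : Type*} [CommRing R]
    [AddCommGroup M] [Module R M] {l : List R} {x : R} (h : IsWeaklyRegular M (l ++ [x])) {m : M}
    (hm : x • m ∈ Ideal.ofList l • (⊤ : Submodule R M)) :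
    m ∈ Ideal.ofList l • (⊤ : Submodule R M) := by
  have := h.regular_mod_prev l.length (by simp)
  rw [isSMulRegular_quotient_iff_mem_of_smul_mem] at this
  simpa using this m (by simpa using hm)

lemma RingTheory.Sequence.IsWeaklyRegular.finsupp {R : Type*} [CommRing R] {l : List R}
    (h : IsWeaklyRegular R l) (ι : Type*) : IsWeaklyRegular (ι →₀ R) l :=
  ((TensorProduct.rid R (ι →₀ R)).isWeaklyRegular_congr l).mp h.isWeaklyRegular_lTensor

lemma exists_pow_pow_eq {S : Type*} [CommRing S] (p : ℕ)
    (hroot : ∀ s : S, ∃ t, t ^ p = s) (e : ℕ) (s : S) :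
    ∃ t, t ^ p ^ e = s := by
  induction e with
  | zero => exact ⟨s, by simp⟩
  | succ e ih =>
    obtain ⟨t, rfl⟩ := ih
    obtain ⟨u, rfl⟩ := hroot t
    exact ⟨u, by rw [pow_succ', pow_mul]⟩

section

variable {R S : Type*} [CommRing R] [IsDomain R] [CommRing S] [IsDomain S] [Algebra R S]
  [Algebra.IsIntegral R S] (p : ℕ) [Fact p.Prime] [CharP S p]

/-- Integral closures of a domain of characteristic `p` are almost Cohen-Macaulay: colons of a
regular sequence are killed by all `p`-power roots of a nonzero element. -/
lemma exists_ne_zero_root_smul_mem (hroot : ∀ s : S, ∃ t, t ^ p = s) {l : List R} {x : R}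
    (h : IsWeaklyRegular R (l ++ [x])) {s : S}
    (hs : x • s ∈ Ideal.ofList l • (⊤ : Submodule R S)) :
    ∃ c : R, c ≠ 0 ∧ ∀ (e : ℕ) (γ : S), γ ^ p ^ e = algebraMap R S c →
      γ * s ∈ Ideal.ofList l • (⊤ : Submodule R S) := by
  rw [Ideal.ofList_eq_span_range_get, Submodule.mem_span_range_smul_top_iff] at hs
  obtain ⟨u, hu⟩ := hs
  let X : Set S := insert s (Set.range u)
  have hX : X.Finite := (Set.finite_range u).insert s
  let T := Algebra.adjoin R X
  have : Module.Finite R T :=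
    Module.Finite.iff_fg.mpr (fg_adjoin_of_finite hX fun z _ ↦ Algebra.IsIntegral.isIntegral z)
  obtain ⟨ι, -, ψ, θ, c, hc, hψ⟩ := Module.Finite.exists_comp_eq_smul R T
  refine ⟨c, hc, fun e γ hγ ↦ ?_⟩
  let s' : T := ⟨s, Algebra.subset_adjoin (Set.mem_insert _ _)⟩
  let u' (i) : T := ⟨u i, Algebra.subset_adjoin (Set.mem_insert_of_mem _ ⟨i, rfl⟩)⟩
  have h1 : x ^ p ^ e • s' ^ p ^ e = ∑ i, l.get i ^ p ^ e • u' i ^ p ^ e := by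
    apply Subtype.ext
    have := congrArg (· ^ p ^ e) hu
    simp only [sum_pow_char_pow, smul_pow] at this
    simpa [s', u'] using this.symm
  have hreg := (h.map_pow (p ^ e)).finsupp ι
  rw [List.map_append, List.map_singleton] at hreg
  have h2 := hreg.mem_of_smul_mem (m := ψ (s' ^ p ^ e)) (by
    rw [Ideal.ofList_map_eq_span_range_get, Submodule.mem_span_range_smul_top_iff]
    exact ⟨fun i ↦ ψ (u' i ^ p ^ e), by rw [← map_smul, h1]; simp⟩)
  rw [Ideal.ofList_map_eq_span_range_get, Submodule.mem_span_range_smul_top_iff] at h2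
  obtain ⟨t, ht⟩ := h2
  have h3 := congrArg (T.val ∘ θ) ht
  simp only [Function.comp_apply, hψ, map_sum, map_smul] at h3
  choose τ hτ using fun i ↦ exists_pow_pow_eq p hroot e (θ (t i))
  rw [Ideal.ofList_eq_span_range_get, Submodule.mem_span_range_smul_top_iff]
  refine ⟨τ, iterateFrobenius_inj S p e ?_⟩
  simp only [iterateFrobenius_def, sum_pow_char_pow, smul_pow, hτ, mul_pow, hγ]
  simpa [Algebra.smul_def, s'] using h3

end

/-- The submonoid of sequences whose valuations tend to `1` from below, relative to a
threshold `g`. -/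
def Valuation.tailSubmonoid {S Γ : Type*} [CommRing S] [LinearOrderedCommGroupWithZero Γ]
    (v : Valuation S Γ) (g : Γ) (hg : g ≤ 1) : Submonoid (ℕ → S) where
  carrier := {c | ∀ K : ℕ, ∀ᶠ N in atTop, g ≤ v (c N) ^ K}
  one_mem' := fun K ↦ .of_forall fun N ↦ by simpa using hg
  mul_mem' := by
    intro c d hc hd K
    filter_upwards [hc (2 * K), hd (2 * K)] with N h1 h2
    rw [Pi.mul_apply, map_mul, mul_pow]
    rw [two_mul, pow_add] at h1 h2
    rcases le_total (v (c N)) (v (d N)) with h | h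
    · exact h1.trans (mul_le_mul_right (pow_le_pow_left₀ zero_le h K) _)
    · exact h2.trans (mul_le_mul_left (pow_le_pow_left₀ zero_le h K) _)

/-- Weakly regular sequences stay weakly regular on the localized product of copies of a
sufficiently root closed integral extension. -/
lemma RingTheory.Sequence.IsWeaklyRegular.of_isLocalization_tailSubmonoid
    {R S W Γ : Type*} [CommRing R] [IsDomain R] [CommRing S] [IsDomain S] [Algebra R S]
    [Algebra.IsIntegral R S] (p : ℕ) [Fact p.Prime] [CharP S p] [CommRing W]
    [LinearOrderedCommGroupWithZero Γ] {v : Valuation S Γ} {g : Γ} {hg : g ≤ 1}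
    [Algebra (ℕ → S) W] [IsLocalization (v.tailSubmonoid g hg) W] [Algebra R W]
    [IsScalarTower R (ℕ → S) W] (hroot : ∀ s : S, ∃ t, t ^ p = s)
    (hv : ∀ c : R, c ≠ 0 → ∃ N : ℕ, g ^ N ≤ v (algebraMap R S c)) {rs : List R}
    (h : IsWeaklyRegular R rs) : IsWeaklyRegular W rs := by
  refine ⟨fun i hi ↦ ?_⟩
  rw [isSMulRegular_quotient_iff_mem_of_smul_mem]
  intro w hw
  set l := rs.take i
  set x := rs[i]
  have hl : IsWeaklyRegular R (l ++ [x]) := by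
    rw [← List.take_append_drop (i + 1) rs, isWeaklyRegular_append_iff] at h
    rw [← List.take_succ_eq_append_getElem hi]
    exact h.1
  rw [Ideal.ofList_eq_span_range_get, Submodule.mem_span_range_smul_top_iff] at hw ⊢
  obtain ⟨u, hu⟩ := hw
  obtain ⟨⟨b, hb⟩, hbw⟩ := IsLocalization.exist_integer_multiples (v.tailSubmonoid g hg)
    Finset.univ (fun o : Option (Fin l.length) ↦ o.elim w u)
  choose f hf using fun o ↦ hbw o (Finset.mem_univ o)
  have hfw : algebraMap (ℕ → S) W (f none) = algebraMap (ℕ → S) W b * w := by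
    rw [hf none, ← Algebra.smul_def]; rfl
  have hfu (k) : algebraMap (ℕ → S) W (f (some k)) = algebraMap (ℕ → S) W b * u k := by
    rw [hf (some k), ← Algebra.smul_def]; rfl
  have hsmul (r : R) (z : ℕ → S) :
      algebraMap (ℕ → S) W (r • z) = r • algebraMap (ℕ → S) W z :=
    (IsScalarTower.toAlgHom R (ℕ → S) W).map_smul_of_tower r z
  have h1 : algebraMap (ℕ → S) W (x • f none) =
      algebraMap (ℕ → S) W (∑ k, l.get k • f (some k)) := by
    have := congrArg (algebraMap (ℕ → S) W b * ·) hu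
    simp only [Finset.mul_sum, mul_smul_comm] at this
    simp only [map_sum, hsmul, hfw, hfu, this]
  obtain ⟨⟨ρ, hρ⟩, h2⟩ := IsLocalization.exists_of_eq (M := v.tailSubmonoid g hg) h1
  have h3 (N : ℕ) : x • (ρ N * f none N) ∈ Ideal.ofList l • (⊤ : Submodule R S) := by
    rw [Ideal.ofList_eq_span_range_get, Submodule.mem_span_range_smul_top_iff]
    refine ⟨fun k ↦ ρ N * f (some k) N, ?_⟩
    have := congrFun h2 N
    simp only [Pi.mul_apply, Pi.smul_apply, Finset.sum_apply, mul_smul_comm, Finset.mul_sum]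
      at this
    exact this.symm
  choose c hc hcγ using fun N ↦ exists_ne_zero_root_smul_mem p hroot hl (h3 N)
  choose E hE using fun N ↦ hv (c N) (hc N)
  have hp : 1 < p := (Fact.out : p.Prime).one_lt
  choose γ hγ using fun N ↦ exists_pow_pow_eq p hroot (E N * N) (algebraMap R S (c N))
  have hγmem : γ ∈ v.tailSubmonoid g hg := by
    intro K
    filter_upwards [eventually_ge_atTop K] with N hN
    have h4 : g ^ p ^ (E N * N) ≤ (v (γ N) ^ K) ^ p ^ (E N * N) := by
      rw [pow_right_comm, ← _root_.map_pow, hγ]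
      calc g ^ p ^ (E N * N) ≤ g ^ (E N * K) :=
            pow_le_pow_right_of_le_one' hg
              ((Nat.mul_le_mul_left _ hN).trans (Nat.lt_pow_self hp).le)
        _ ≤ v (algebraMap R S (c N)) ^ K := by
            rw [pow_mul]
            exact pow_le_pow_left₀ zero_le (hE N) K
    exact le_of_pow_le_pow_left₀ (pow_pos (by lia) _).ne' zero_le h4
  choose d hd using fun N ↦ (Submodule.mem_span_range_smul_top_iff _ _).mp
    (Ideal.ofList_eq_span_range_get l ▸ hcγ N _ (γ N) (hγ N))
  have hunit : IsUnit (algebraMap (ℕ → S) W (γ * ρ * b)) :=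
    IsLocalization.map_units W (⟨γ * ρ * b, mul_mem (mul_mem hγmem hρ) hb⟩ :
      v.tailSubmonoid g hg)
  obtain ⟨η, hη⟩ := hunit.exists_left_inv
  refine ⟨fun k ↦ η * algebraMap (ℕ → S) W (fun N ↦ d N k), ?_⟩
  have h5 : ∑ k, l.get k • (fun N ↦ d N k : ℕ → S) = γ * ρ * f none := by
    funext N
    simpa [mul_assoc] using hd N
  have h6 := congrArg (algebraMap (ℕ → S) W) h5
  simp only [map_sum, hsmul, map_mul, hfw] at h6 hη
  simp only [← mul_smul_comm, ← Finset.mul_sum, h6]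
  linear_combination w * hη

/-- Elements of positive value generate a proper ideal of the localized product of copies. -/
lemma one_notMem_span_of_isLocalization_tailSubmonoid
    {S W Γ : Type*} [CommRing S] (p : ℕ) [Fact p.Prime] [CharP S p] [CommRing W]
    [LinearOrderedCommGroupWithZero Γ] {v : Valuation S Γ} {g : Γ} (hg0 : 0 < g) (hg1 : g < 1)
    [Algebra (ℕ → S) W] [IsLocalization (v.tailSubmonoid g hg1.le) W] (hv : ∀ s, v s ≤ 1)
    {ι : Type*} [Fintype ι] (e : ℕ) (t : ι → S) (ht : ∀ i, v (t i) ^ p ^ e ≤ g) :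
    (1 : W) ∉ Ideal.span (Set.range fun i ↦ algebraMap (ℕ → S) W fun _ ↦ t i) := by
  intro h
  obtain ⟨u, hu⟩ := Ideal.mem_span_range_iff_exists_fun.mp h
  obtain ⟨⟨b, hb⟩, hbw⟩ := IsLocalization.exist_integer_multiples
    (v.tailSubmonoid g hg1.le) Finset.univ u
  choose f hf using fun i ↦ hbw i (Finset.mem_univ i)
  have h1 : algebraMap (ℕ → S) W (∑ i, f i * fun _ ↦ t i) = algebraMap (ℕ → S) W b := by
    simp only [map_sum, map_mul, hf, Algebra.smul_def, mul_assoc, ← Finset.mul_sum, hu, mul_one]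
  obtain ⟨⟨ρ, hρ⟩, h2⟩ :=
    IsLocalization.exists_of_eq (M := v.tailSubmonoid g hg1.le) h1
  obtain ⟨N, hN⟩ := (mul_mem hρ hb (p ^ e * 2)).exists
  have h3 := congrFun h2 N
  simp only [Pi.mul_apply, Finset.sum_apply] at h3
  have h4 : v (ρ N * b N) ^ p ^ e ≤ g := by
    rw [← h3, ← map_pow, mul_pow, sum_pow_char_pow, map_mul]
    refine (mul_le_of_le_one_left' (hv _)).trans (v.map_sum_le fun i _ ↦ ?_)
    rw [mul_pow, map_mul, map_pow v (t i)]
    exact (mul_le_of_le_one_left' (hv _)).trans (ht i)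
  rw [Pi.mul_apply, pow_mul] at hN
  have h5 := hN.trans (pow_le_pow_left₀ zero_le h4 2)
  rw [pow_two] at h5
  exact h5.not_gt (mul_lt_of_lt_one_left hg0 hg1)

end TailLocalization

section LechIndependent

open TensorProduct IsLocalRing

/-- If `Tor₁(U, k) = 0`, the coefficients in `U` of a relation between minimal generators of the
maximal ideal lie in `𝔪 U`. -/
lemma TorOneVanishes.mem_smul_top {R : Type*} [CommRing R] [IsLocalRing R] {U : Type _}
    [AddCommGroup U] [Module R U] (h : TorOneVanishes R U (ResidueField R))
    {ι : Type*} [Fintype ι] (b : Module.Basis ι (ResidueField R) (CotangentSpace R))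
    {y : ι → maximalIdeal R} (hy : ∀ i, (maximalIdeal R).toCotangent (y i) = b i) {a : ι → U}
    (ha : ∑ i, (y i : R) • a i = 0) (i : ι) :
    a i ∈ maximalIdeal R • (⊤ : Submodule R U) := by
  classical
  have hinj := h _ _ (maximalIdeal R).subtype (Submodule.mkQ (maximalIdeal R))
    Subtype.val_injective (LinearMap.exact_subtype_mkQ _) (Submodule.mkQ_surjective _)
  have h0 : ∑ j, a j ⊗ₜ[R] y j = 0 := by
    refine hinj ?_
    have h1 (j : ι) : a j ⊗ₜ[R] (y j : R) = ((y j : R) • a j) ⊗ₜ[R] (1 : R) := by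
      rw [smul_tmul, smul_eq_mul, mul_one]
    simp only [map_sum, LinearMap.lTensor_tmul, Submodule.subtype_apply, h1, ← sum_tmul, ha,
      zero_tmul, map_zero]
  let φ : maximalIdeal R →ₗ[R] R ⧸ maximalIdeal R :=
    ((b.coord i).restrictScalars R) ∘ₗ (maximalIdeal R).toCotangent
  have hφ (j) : φ (y j) = if j = i then 1 else 0 := by
    have : φ (y j) = b.coord i ((maximalIdeal R).toCotangent (y j)) := rfl
    rw [this, hy, b.coord_apply, b.repr_self, Finsupp.single_apply]
    rfl
  have h1 := congrArg (φ.lTensor U) h0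
  have h2 : a i ⊗ₜ[R] (1 : R ⧸ maximalIdeal R) = 0 := by
    simpa [hφ, tmul_ite] using h1
  have h3 := congrArg (tensorQuotEquivQuotSMul U (maximalIdeal R)) h2
  rw [map_zero] at h3
  have h4 := tensorQuotEquivQuotSMul_tmul_mk (maximalIdeal R) (a i) 1
  rw [map_one] at h4
  rw [h4, one_smul, Submodule.Quotient.mk_eq_zero] at h3
  exact h3

lemma Ideal.span_range_le_span_range_update {W ι : Type*} [CommRing W] [DecidableEq ι] {w : ι → W}
    {i : ι} {f g : W} (h : w i = f * g) :
    Ideal.span (Set.range w) ≤ Ideal.span (Set.range (Function.update w i f)) := by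
  rw [Ideal.span_le]
  rintro _ ⟨j, rfl⟩
  by_cases hj : j = i
  · subst hj
    rw [h]
    exact Ideal.mul_mem_right _ _ (Ideal.subset_span ⟨j, by simp⟩)
  · exact Ideal.subset_span ⟨j, by simp [hj]⟩

variable {W ι : Type*} [CommRing W] [Fintype ι]

/-- A family `w` is Lech independent if the coefficients of every relation between its members
lie in the ideal generated by `w`. -/
def IsLechIndependent (w : ι → W) : Prop :=
  ∀ a : ι → W, ∑ i, a i * w i = 0 → ∀ i, a i ∈ Ideal.span (Set.range w)

variable [DecidableEq ι] {w : ι → W} {i : ι} {f g : W}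

lemma IsLechIndependent.update (hw : IsLechIndependent w) (h : w i = f * g) :
    IsLechIndependent (Function.update w i f) := by
  intro a ha
  have hle := Ideal.span_range_le_span_range_update h
  have hsum (c : ι → W) (z : W) : ∑ j, c j * Function.update w i z j =
      (∑ j ∈ Finset.univ.erase i, c j * w j) + c i * z := by
    rw [← Finset.sum_erase_add _ _ (Finset.mem_univ i), Function.update_self]
    congr 1
    exact Finset.sum_congr rfl fun j hj ↦ by rw [Function.update_of_ne (Finset.ne_of_mem_erase hj)]
  rw [hsum] at ha
  have hsum' (c : ι → W) : ∑ j, c j * w j =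
      (∑ j ∈ Finset.univ.erase i, c j * w j) + c i * w i := by
    rw [← hsum, Function.update_eq_self]
  have hi : a i ∈ Ideal.span (Set.range w) := by
    have := hw (Function.update (fun j ↦ g * a j) i (a i)) (by
      rw [hsum', Function.update_self, h, Finset.sum_congr rfl (g := fun j ↦ g * (a j * w j)) fun
        j hj ↦ by rw [Function.update_of_ne (Finset.ne_of_mem_erase hj), mul_assoc],
        ← Finset.mul_sum]
      linear_combination g * ha) i
    rwa [Function.update_self] at this
  intro j
  by_cases hj : j = i
  · exact hj ▸ hle hi
  obtain ⟨c, hc⟩ := Ideal.mem_span_range_iff_exists_fun.mp hi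
  rw [hsum'] at hc
  have := hw (fun j ↦ (if j = i then 0 else a j) + c j * f) (by
    rw [hsum', Finset.sum_congr rfl (g := fun j ↦ a j * w j + f * (c j * w j)) fun
        j hj ↦ by rw [if_neg (Finset.ne_of_mem_erase hj)]; ring, Finset.sum_add_distrib,
        ← Finset.mul_sum, if_pos rfl]
    linear_combination ha + f * hc) j
  rw [if_neg hj] at this
  have hf : c j * f ∈ Ideal.span (Set.range (Function.update w i f)) :=
    Ideal.mul_mem_left _ _ (Ideal.subset_span ⟨i, by simp⟩)
  exact (Ideal.add_mem_iff_left _ hf).mp (hle this)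

lemma IsLechIndependent.mem_span_update (hw : IsLechIndependent w) (h : w i = f * g) {z : W}
    (hz : g * z ∈ Ideal.span (Set.range w)) :
    z ∈ Ideal.span (Set.range (Function.update w i f)) := by
  obtain ⟨c, hc⟩ := Ideal.mem_span_range_iff_exists_fun.mp hz
  rw [← Finset.sum_erase_add _ _ (Finset.mem_univ i), h] at hc
  have := hw (fun j ↦ if j = i then c i * f - z else f * c j) (by
    rw [← Finset.sum_erase_add _ _ (Finset.mem_univ i), if_pos rfl, h,
      Finset.sum_congr rfl (g := fun j ↦ f * (c j * w j)) fun
        j hj ↦ by rw [if_neg (Finset.ne_of_mem_erase hj)]; ring, ← Finset.mul_sum]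
    linear_combination f * hc) i
  rw [if_pos rfl] at this
  have hf : c i * f ∈ Ideal.span (Set.range (Function.update w i f)) :=
    Ideal.mul_mem_left _ _ (Ideal.subset_span ⟨i, by simp⟩)
  simpa using sub_mem hf (Ideal.span_range_le_span_range_update h this)

/-- Lech's argument: if the `Q`-th powers of a family are Lech independent and the product of the
`(Q - 1)`-st powers is in the ideal they generate, then the family generates the unit ideal. -/
lemma IsLechIndependent.one_mem_span {t : ι → W} {q : ℕ}
    (h : IsLechIndependent fun i ↦ t i ^ (q + 1))
    (hmem : ∏ i, t i ^ q ∈ Ideal.span (Set.range fun i ↦ t i ^ (q + 1))) :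
    1 ∈ Ideal.span (Set.range t) := by
  have key (s : Finset ι) : IsLechIndependent (fun i ↦ if i ∈ s then t i else t i ^ (q + 1)) ∧
      ∏ i ∈ sᶜ, t i ^ q ∈ Ideal.span (Set.range fun i ↦ if i ∈ s then t i else t i ^ (q + 1)) := by
    induction s using Finset.induction_on with
    | empty => simpa using ⟨h, hmem⟩
    | insert i s hi ih =>
      have hup : (fun j ↦ if j ∈ insert i s then t j else t j ^ (q + 1)) =
          Function.update (fun j ↦ if j ∈ s then t j else t j ^ (q + 1)) i (t i) := by
        funext j
        by_cases hj : j = i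
        · subst hj; simp
        · simp [hj]
      have hfac : (fun j ↦ if j ∈ s then t j else t j ^ (q + 1)) i = t i * t i ^ q := by
        simp [hi, pow_succ']
      rw [hup]
      refine ⟨ih.1.update hfac, ih.1.mem_span_update hfac ?_⟩
      rw [Finset.compl_insert, Finset.mul_prod_erase _ (fun j ↦ t j ^ q) (by simpa using hi)]
      exact ih.2
  simpa using (key Finset.univ).2

end LechIndependent

section MonomialLength

open Function
open scoped Pointwise

lemma Module.length_le_add_of_exact {R A B C : Type*} [CommRing R] [AddCommGroup A] [Module R A]
    [AddCommGroup B] [Module R B] [AddCommGroup C] [Module R C] {f : A →ₗ[R] B} {g : B →ₗ[R] C}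
    (hfg : Exact f g) (hg : Surjective g) :
    Module.length R B ≤ Module.length R A + Module.length R C := by
  have h : Exact (LinearMap.range f).subtype g := fun x ↦ by simpa using! hfg x
  rw [Module.length_eq_add_of_exact _ g (Submodule.subtype_injective _) hg h]
  exact add_le_add_left
    (Module.length_le_of_surjective f.rangeRestrict f.surjective_rangeRestrict) _

lemma QuotSMulTop.length_pow_le {R M : Type*} [CommRing R] [AddCommGroup M] [Module R M] (x : R)
    (a : ℕ) : Module.length R (QuotSMulTop (x ^ a) M) ≤ a * Module.length R (QuotSMulTop x M) := by
  induction a with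
  | zero => simp
  | succ a ih =>
    obtain ⟨f, g, hfg, hg, -⟩ := QuotSMulTop.exists_exact_pow (M := M) x a
    refine (Module.length_le_add_of_exact hfg hg).trans ?_
    rw [Nat.cast_succ, add_mul, one_mul]
    exact add_le_add_left ih _

/-- The length of `M/(x₁^q, …, x_d^q)M` is at most `q ^ d` times that of `M/(x₁, …, x_d)M`. -/
lemma Module.length_quotient_ofList_pow_le {R M : Type*} [CommRing R] [AddCommGroup M]
    [Module R M] (rs : List R) (q : ℕ) :
    Module.length R (M ⧸ (Ideal.ofList (rs.map (· ^ q)) • ⊤ : Submodule R M)) ≤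
      q ^ rs.length * Module.length R (M ⧸ (Ideal.ofList rs • ⊤ : Submodule R M)) := by
  induction rs generalizing M with
  | nil => rw [List.map_nil, List.length_nil, pow_zero, one_mul]
  | cons r rs ih =>
    rw [List.map_cons,
      (Submodule.quotOfListConsSMulTopEquivQuotSMulTopInner M (r ^ q) _).length_eq]
    refine ih.trans ?_
    rw [← (Submodule.quotOfListConsSMulTopEquivQuotSMulTopInner M (r ^ q) rs).length_eq,
      (Submodule.quotOfListConsSMulTopEquivQuotSMulTopOuter M (r ^ q) rs).length_eq,
      (Submodule.quotOfListConsSMulTopEquivQuotSMulTopOuter M r rs).length_eq,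
      List.length_cons, pow_succ, mul_assoc]
    exact mul_le_mul_right (QuotSMulTop.length_pow_le r q) _

/-- If `y₁, …, yₙ` satisfy `yᵢ^(q+1) = 0` and the product of the `yᵢ^q` is nonzero, there is a
chain of `(q + 1) ^ n` ideals generated by monomials. -/
lemma Module.pow_le_length_add_one {A : Type*} [CommRing A] {n q : ℕ} {y : Fin n → A}
    (hy : ∀ i, y i ^ (q + 1) = 0) (hprod : ∏ i, y i ^ q ≠ 0) :
    (((q + 1) ^ n : ℕ) : ℕ∞) ≤ Module.length A A + 1 := by
  let mon (b : Lex (Fin n → Fin (q + 1))) : A := ∏ i, y i ^ (ofLex b i : ℕ)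
  let J (a : (Lex (Fin n → Fin (q + 1)))ᵒᵈ) : Ideal A :=
    Ideal.span (mon '' Set.Ici (OrderDual.ofDual a))
  have hmono : StrictMono J := by
    intro a' a h
    have hlt : OrderDual.ofDual a < OrderDual.ofDual a' := h
    refine lt_of_le_of_ne (Ideal.span_mono (Set.image_mono (Set.Ici_subset_Ici.mpr hlt.le))) ?_
    intro heq
    have hmem : mon (OrderDual.ofDual a) ∈ J a' :=
      heq ▸ Ideal.subset_span ⟨_, Set.self_mem_Ici, rfl⟩
    let c : A := ∏ i, y i ^ (q - (ofLex (OrderDual.ofDual a) i : ℕ))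
    have hc : c * mon (OrderDual.ofDual a) = ∏ i, y i ^ q := by
      rw [← Finset.prod_mul_distrib]
      refine Finset.prod_congr rfl fun i _ ↦ ?_
      rw [← pow_add, Nat.sub_add_cancel (Nat.le_of_lt_succ (Fin.is_lt _))]
    have hle : J a' ≤ LinearMap.ker (LinearMap.mulLeft A c) := by
      rw [Ideal.span_le]
      rintro _ ⟨b, hb, rfl⟩
      obtain ⟨i, hi⟩ : ∃ i, ofLex (OrderDual.ofDual a) i < ofLex b i := by
        by_contra! hba
        exact (hlt.trans_le hb).not_ge (Pi.toLex_monotone hba)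
      rw [SetLike.mem_coe, LinearMap.mem_ker, LinearMap.mulLeft_apply, ← Finset.prod_mul_distrib]
      refine Finset.prod_eq_zero (Finset.mem_univ i) ?_
      rw [← pow_add]
      exact pow_eq_zero_of_le (by lia) (hy i)
    have := hle hmem
    rw [LinearMap.mem_ker, LinearMap.mulLeft_apply, hc] at this
    exact hprod this
  have hcard : Fintype.card (Lex (Fin n → Fin (q + 1)))ᵒᵈ = (q + 1) ^ n - 1 + 1 := by
    rw [Nat.sub_add_cancel (Nat.one_le_pow _ _ (Nat.succ_pos q))]
    simp
  let e := Fintype.orderIsoFinOfCardEq _ hcard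
  have h1 := Order.LTSeries.length_le_krullDim
    (LTSeries.mk _ (J ∘ e) (hmono.comp e.strictMono))
  rw [← Module.coe_length] at h1
  have h2 : (((q + 1) ^ n - 1 : ℕ) : ℕ∞) ≤ Module.length A A := by exact_mod_cast h1
  calc (((q + 1) ^ n : ℕ) : ℕ∞) = (((q + 1) ^ n - 1 : ℕ) : ℕ∞) + 1 := by
        rw [← Nat.cast_succ, Nat.succ_eq_add_one,
          Nat.sub_add_cancel (Nat.one_le_pow _ _ (Nat.succ_pos q))]
    _ ≤ _ := add_le_add_left h2 1

/-- A family `y` containing a sequence `xs` with `R/(xs)` of finite length in the ideal it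
generates, and such that no `∏ yᵢ^(q-1)` lies in `(y₁^q, …, yₙ^q)` for `q` a power of `p`, has at
most as many members as `xs`. -/
lemma le_length_of_prod_pow_notMem {R : Type*} [CommRing R] (p : ℕ) [Fact p.Prime] [CharP R p]
    {n : ℕ} {y : Fin n → R} {xs : List R} (hxs : ∀ x ∈ xs, x ∈ Ideal.span (Set.range y))
    (hlen : Module.length R (R ⧸ (Ideal.ofList xs • ⊤ : Submodule R R)) ≠ ⊤)
    (hy : ∀ e : ℕ, ∏ i, y i ^ (p ^ e - 1) ∉ Ideal.span (Set.range fun i ↦ y i ^ p ^ e)) :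
    n ≤ xs.length := by
  obtain ⟨L, hL⟩ := ENat.ne_top_iff_exists.mp hlen
  have key (e : ℕ) : (p ^ e) ^ n ≤ (p ^ e) ^ xs.length * L + 1 := by
    obtain ⟨q, hq⟩ : ∃ q, p ^ e = q + 1 :=
      Nat.exists_eq_add_one.mpr (pow_pos (Fact.out : p.Prime).pos e)
    have hye := hy e
    set I := Ideal.span (Set.range fun i ↦ y i ^ p ^ e)
    have h1 : (((q + 1) ^ n : ℕ) : ℕ∞) ≤ Module.length (R ⧸ I) (R ⧸ I) + 1 := by
      refine Module.pow_le_length_add_one (y := fun i ↦ Ideal.Quotient.mk I (y i)) (fun i ↦ ?_) ?_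
      · rw [← hq, ← map_pow, Ideal.Quotient.eq_zero_iff_mem]
        exact Ideal.subset_span ⟨i, rfl⟩
      · rw [hq, Nat.add_sub_cancel] at hye
        simpa only [← map_pow, ← map_prod, ne_eq, Ideal.Quotient.eq_zero_iff_mem] using hye
    rw [← Module.length_eq_of_surjective (S := R) Ideal.Quotient.mk_surjective] at h1
    have hle : (Ideal.ofList (xs.map (· ^ p ^ e)) • ⊤ : Submodule R R) ≤ I := by
      rw [smul_eq_mul, Ideal.mul_top, Ideal.span_le]
      intro z hz
      obtain ⟨x, hx, rfl⟩ := List.mem_map.mp hz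
      obtain ⟨c, rfl⟩ := Ideal.mem_span_range_iff_exists_fun.mp (hxs x hx)
      simp only [sum_pow_char_pow, mul_pow, SetLike.mem_coe]
      exact sum_mem fun i _ ↦ Ideal.mul_mem_left _ _ (Ideal.subset_span ⟨i, rfl⟩)
    have h2 := (Module.length_le_of_surjective (Submodule.factor hle)
      (Submodule.factor_surjective hle)).trans (Module.length_quotient_ofList_pow_le xs (p ^ e))
    rw [← hL] at h2
    rw [hq] at h2 ⊢
    exact_mod_cast h1.trans (add_le_add_left h2 1)
  by_contra! hn
  have hp := (Fact.out : p.Prime).one_lt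
  have h1 := key (L + 1)
  set Q := p ^ (L + 1)
  have hQ : L + 1 < Q := Nat.lt_pow_self hp
  have h2 : Q ^ (xs.length + 1) ≤ Q ^ n := Nat.pow_le_pow_right (by lia) hn
  have h3 : 0 < Q ^ xs.length := pow_pos (by lia) _
  rw [pow_succ] at h2
  nlinarith

end MonomialLength

section Regularity

universe u

open TensorProduct IsLocalRing RingTheory.Sequence
open scoped Pointwise

lemma isFiniteLength_quotient_ofList {R : Type*} [CommRing R] [IsNoetherianRing R] [IsLocalRing R]
    {rs : List R} (hreg : IsRegular R rs) (hlen : (rs.length : WithBot ℕ∞) = ringKrullDim R) :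
    IsFiniteLength R (R ⧸ (Ideal.ofList rs • ⊤ : Submodule R R)) := by
  rw [smul_eq_mul, Ideal.mul_top]
  have hne : Ideal.ofList rs ≠ ⊤ := fun h ↦ hreg.top_ne_smul (by simp [h])
  have : Nontrivial (R ⧸ Ideal.ofList rs) := Ideal.Quotient.nontrivial_iff.mpr hne
  have h := ringKrullDim_add_length_eq_ringKrullDim_of_isRegular rs hreg
  have h0 : Ring.KrullDimLE 0 (R ⧸ Ideal.ofList rs) := by
    rw [Ring.krullDimLE_iff]
    rw [← hlen] at h
    generalize ringKrullDim (R ⧸ Ideal.ofList rs) = d at h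
    induction d with
    | bot => simp
    | coe d =>
      induction d with
      | top => norm_cast at h
      | coe d => norm_cast at h ⊢; omega
  have : IsArtinianRing (R ⧸ Ideal.ofList rs) := isArtinianRing_iff_krullDimLE_zero.mpr h0
  rw [isFiniteLength_iff_isNoetherian_isArtinian]
  refine ⟨inferInstance, ?_⟩
  exact isArtinian_of_surjective_algebraMap (S := R) (R := R ⧸ Ideal.ofList rs)
    Ideal.Quotient.mk_surjective

/-- Over a Cohen-Macaulay local ring, the vanishing of one positive `Tor` of a balanced
Cohen-Macaulay module against the residue field implies that of the first. -/
lemma TorSuccVanishes.torOneVanishes_of_isRegular {R U : Type u} [CommRing R] [IsNoetherianRing R]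
    [IsLocalRing R] [AddCommGroup U] [Module R U] {rs : List R} (hreg : IsRegular R rs)
    (hlen : (rs.length : WithBot ℕ∞) = ringKrullDim R) (hU : IsWeaklyRegular U rs) {r : ℕ}
    (h : TorSuccVanishes R r U (ResidueField R)) : TorOneVanishes R U (ResidueField R) := by
  have : Nontrivial (R ⧸ (Ideal.ofList rs • ⊤ : Submodule R R)) :=
    Submodule.Quotient.nontrivial_iff.mpr hreg.top_ne_smul.symm
  exact TorSuccVanishes.torOneVanishes_residueField (isFiniteLength_quotient_ofList hreg hlen)
    (.quot_ofList rs hreg.toIsWeaklyRegular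
      (((TensorProduct.rid R U).isWeaklyRegular_congr rs).mpr hU) fun _ ↦ .of_flat_right _) h

lemma prod_pow_notMem_of_torOneVanishes {R : Type u} [CommRing R] [IsLocalRing R] (p : ℕ)
    [Fact p.Prime] {S : Type*} {W : Type u} [CommRing S] [IsReduced S] [CharP S p] [Algebra R S]
    [CommRing W]
    [Algebra R W] (ψ : S →ₐ[R] W) (hroot : ∀ s : S, ∃ t, t ^ p = s)
    (h : TorOneVanishes R W (ResidueField R)) {ι : Type*} [Fintype ι]
    (b : Module.Basis ι (ResidueField R) (CotangentSpace R)) {y : ι → maximalIdeal R}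
    (hy : ∀ i, (maximalIdeal R).toCotangent (y i) = b i)
    (hspan : Ideal.span (Set.range fun i ↦ (y i : R)) = maximalIdeal R) (e : ℕ)
    (hproper : ∀ t : ι → S, (∀ i, t i ^ p ^ e = algebraMap R S (y i)) →
      (1 : W) ∉ Ideal.span (Set.range fun i ↦ ψ (t i))) :
    ∏ i, (y i : R) ^ (p ^ e - 1) ∉ Ideal.span (Set.range fun i ↦ (y i : R) ^ p ^ e) := by
  classical
  intro hmem
  obtain ⟨q, hq⟩ : ∃ q, p ^ e = q + 1 :=
    Nat.exists_eq_add_one.mpr (pow_pos (Fact.out : p.Prime).pos e)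
  choose t ht using fun i ↦ exists_pow_pow_eq p hroot e (algebraMap R S (y i))
  refine hproper t ht (IsLechIndependent.one_mem_span (q := q) ?_ ?_)
  · intro a ha i
    have hw : (fun i ↦ ψ (t i) ^ (q + 1)) = fun i ↦ algebraMap R W (y i) := by
      funext i
      rw [← map_pow, ← hq, ht, ψ.commutes]
    have := h.mem_smul_top b hy (a := a) (by
      rw [← ha]
      exact Finset.sum_congr rfl fun i _ ↦ by
        rw [Algebra.smul_def, mul_comm, ← congrFun hw i]) i
    rw [Ideal.smul_top_eq_map, Submodule.restrictScalars_mem, ← hspan, Ideal.map_span,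
      ← Set.range_comp] at this
    rw [hw]
    exact this
  · obtain ⟨c, hc⟩ := Ideal.mem_span_range_iff_exists_fun.mp hmem
    choose d hd using fun i ↦ exists_pow_pow_eq p hroot e (algebraMap R S (c i))
    have : ∑ i, d i * t i ^ p ^ e = ∏ i, t i ^ (p ^ e - 1) := by
      apply iterateFrobenius_inj S p e
      have := congrArg (algebraMap R S) hc
      simp only [map_sum, map_mul, map_pow, map_prod, iterateFrobenius_def, ht, hd] at this ⊢
      rw [this]
    have := congrArg ψ this
    simp only [map_sum, map_mul, map_pow, map_prod, hq, Nat.add_sub_cancel] at this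
    rw [← this]
    exact sum_mem fun i _ ↦ Ideal.mul_mem_left _ _ (Ideal.subset_span ⟨i, rfl⟩)

lemma exists_basis_cotangentSpace (R : Type*) [CommRing R] [IsNoetherianRing R] [IsLocalRing R] :
    ∃ (b : Module.Basis (Fin (Module.finrank (ResidueField R) (CotangentSpace R)))
      (ResidueField R) (CotangentSpace R))
      (y : Fin (Module.finrank (ResidueField R) (CotangentSpace R)) → maximalIdeal R),
      (∀ i, (maximalIdeal R).toCotangent (y i) = b i) ∧
      Ideal.span (Set.range fun i ↦ (y i : R)) = maximalIdeal R := by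
  let b := Module.finBasis (ResidueField R) (CotangentSpace R)
  choose y hy using fun i ↦ (maximalIdeal R).toCotangent_surjective (b i)
  refine ⟨b, y, hy, ?_⟩
  have h1 : Submodule.span (ResidueField R)
      ((maximalIdeal R).toCotangent '' Set.range y) = ⊤ := by
    rw [← Set.range_comp, ← b.span_eq]
    exact congrArg _ (congrArg _ (funext hy))
  have := congrArg (Submodule.map (maximalIdeal R).subtype)
    (CotangentSpace.span_image_eq_top_iff.mp h1)
  rw [Submodule.map_span, ← Set.range_comp] at this
  rwa [Submodule.map_top, Submodule.range_subtype] at this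

lemma finrank_cotangentSpace_le_of_torOneVanishes {R : Type u} [CommRing R] [IsNoetherianRing R]
    [IsLocalRing R] (p : ℕ) [Fact p.Prime] [CharP R p] {S : Type*} {W : Type u} [CommRing S]
    [IsReduced S] [CharP S p] [Algebra R S] [CommRing W] [Algebra R W] (ψ : S →ₐ[R] W)
    (hroot : ∀ s : S, ∃ t, t ^ p = s) (h : TorOneVanishes R W (ResidueField R))
    (hproper : ∀ (n e : ℕ) (t : Fin n → S) (y : Fin n → maximalIdeal R),
      (∀ i, t i ^ p ^ e = algebraMap R S (y i)) →
      (1 : W) ∉ Ideal.span (Set.range fun i ↦ ψ (t i)))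
    {rs : List R} (hrs : ∀ x ∈ rs, x ∈ maximalIdeal R) (hreg : IsRegular R rs)
    (hlen : (rs.length : WithBot ℕ∞) = ringKrullDim R) :
    Module.finrank (ResidueField R) (CotangentSpace R) ≤ rs.length := by
  obtain ⟨b, y, hy, hspan⟩ := exists_basis_cotangentSpace R
  refine le_length_of_prod_pow_notMem p (y := fun i ↦ (y i : R)) (fun x hx ↦ ?_) ?_ fun e ↦ ?_
  · rw [hspan]
    exact hrs x hx
  · exact Module.length_ne_top_iff.mpr (isFiniteLength_quotient_ofList hreg hlen)
  · exact prod_pow_notMem_of_torOneVanishes p ψ hroot h b hy hspan e fun t ht ↦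
      hproper _ e t y ht

end Regularity

section AbsoluteIntegralClosure

open IsLocalRing RingTheory.Sequence

/-- The constant map to a localization of a power of `S`. -/
noncomputable def constLocalization {S : Type*} (R ι : Type*) [CommRing R] [CommRing S]
    [Algebra R S] (M : Submonoid (ι → S)) : S →ₐ[R] Localization M :=
  (IsScalarTower.toAlgHom R (ι → S) (Localization M)).comp (Pi.constAlgHom R ι S)

lemma exists_pow_eq_absIntClo (R : Type) [CommRing R] [IsDomain R] {p : ℕ} (hp : 0 < p)
    (s : AbsIntClo R) : ∃ t, t ^ p = s := by
  obtain ⟨t, ht⟩ := IsAlgClosed.exists_pow_nat_eq (s : AlgebraicClosure (FractionRing R)) hp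
  exact ⟨⟨t, IsIntegral.of_pow hp (ht ▸ s.2)⟩, Subtype.ext ht⟩

lemma faithfulSMul_algebraicClosure_fractionRing (R : Type*) [CommRing R] [IsDomain R] :
    FaithfulSMul R (AlgebraicClosure (FractionRing R)) :=
  .trans R (FractionRing R) _

lemma charP_absIntClo (R : Type) [CommRing R] [IsDomain R] (p : ℕ) [CharP R p] :
    CharP (AbsIntClo R) p := by
  have := faithfulSMul_algebraicClosure_fractionRing R
  exact charP_of_injective_algebraMap (A := AbsIntClo R) (fun x y h ↦
    FaithfulSMul.algebraMap_injective R (AlgebraicClosure (FractionRing R))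
      (congrArg (Subtype.val : AbsIntClo R → _) h)) p

lemma ValuationSubring.valuation_le_one_of_isIntegral {R K : Type*} [CommRing R] [Field K]
    [Algebra R K] (V : ValuationSubring K) (hV : ∀ z : R, V.valuation (algebraMap R K z) ≤ 1)
    {x : K} (hx : IsIntegral R x) : V.valuation x ≤ 1 := by
  rw [V.valuation_le_one_iff]
  let f : R →+* V := (algebraMap R K).codRestrict V.toSubring fun z ↦
    (V.valuation_le_one_iff _).mp (hV z)
  have : IsIntegral V x := by
    obtain ⟨P, hP, h⟩ := hx
    exact ⟨P.map f, hP.map f, by rwa [Polynomial.eval₂_map]⟩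
  obtain ⟨y, rfl⟩ := IsIntegrallyClosed.isIntegral_iff.mp this
  exact y.2

lemma isRegularLocalRing_of_tor_absIntClo (R : Type) [CommRing R] [IsDomain R] [IsNoetherianRing R]
    [IsLocalRing R] (hCM : IsCohenMacaulayLocalRing R) (p : ℕ) (hp : p.Prime) [CharP R p]
    (j : ℕ) (hj : 1 ≤ j) (htor : Subsingleton (TorGrp R j (AbsIntClo R) (ResidueField R))) :
    IsRegularLocalRing R := by
  by_cases hF : IsField R
  · let := hF.toField
    infer_instance
  have : Fact p.Prime := ⟨hp⟩
  have := charP_absIntClo R p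
  have := faithfulSMul_algebraicClosure_fractionRing R
  obtain ⟨-, _, rs, hrs, hreg, hlen⟩ := hCM
  obtain ⟨V, y₀, hV1, hy0, hy1, hm, hc⟩ :=
    exists_dominating_valuationSubring hF (AlgebraicClosure (FractionRing R))
  let v := V.valuation.comap (algebraMap (AbsIntClo R) (AlgebraicClosure (FractionRing R)))
  let g := V.valuation (algebraMap R (AlgebraicClosure (FractionRing R)) y₀)
  have hg0 : 0 < g := by
    rw [zero_lt_iff, Ne, map_eq_zero]
    simpa using hy0
  have hvR (z : R) : v (algebraMap R (AbsIntClo R) z) =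
      V.valuation (algebraMap R (AlgebraicClosure (FractionRing R)) z) := rfl
  have hv1 (s : AbsIntClo R) : v s ≤ 1 := V.valuation_le_one_of_isIntegral hV1 s.2
  have hroot := exists_pow_eq_absIntClo R hp.pos
  let M := v.tailSubmonoid g hy1.le
  have hW : IsWeaklyRegular (Localization M) rs :=
    .of_isLocalization_tailSubmonoid (v := v) (g := g) (hg := hy1.le) p hroot hc
      hreg.toIsWeaklyRegular
  obtain ⟨r, rfl⟩ := Nat.exists_eq_add_of_le' hj
  have hTor : TorOneVanishes R (Localization M) (ResidueField R) :=
    TorSuccVanishes.torOneVanishes_of_isRegular hreg hlen hW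
      ((torSuccVanishes_of_subsingleton_tor r htor).localization M)
  have hle : Module.finrank (ResidueField R) (CotangentSpace R) ≤ rs.length := by
    refine finrank_cotangentSpace_le_of_torOneVanishes p (constLocalization R ℕ M) hroot hTor
      (fun n e t y hty ↦ ?_) hrs hreg hlen
    refine one_notMem_span_of_isLocalization_tailSubmonoid (v := v) p hg0 hy1 hv1 e t fun i ↦ ?_
    rw [← map_pow, hty, hvR]
    exact hm _ (y i).2
  refine IsRegularLocalRing.of_spanFinrank_maximalIdeal_le R ?_
  rw [spanFinrank_maximalIdeal_eq_finrank_cotangentSpace, ← hlen]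
  exact_mod_cast hle

end AbsoluteIntegralClosure

/-- Let `(R, 𝔪)` be an excellent local Cohen-Macaulay domain of prime characteristic `p`
with an isolated singularity or of Krull dimension at most `2`. If
`Tor_j^R(R⁺, k) = 0` for some `j ≥ 1`, then `R` is regular. -/
theorem regular_of_some_betti_vanishing
    (R : Type) [CommRing R] [IsDomain R] [IsNoetherianRing R] [IsLocalRing R]
    (hExc : IsExcellentRing R) (hCM : IsCohenMacaulayLocalRing R)
    (p : ℕ) (hp : p.Prime) [CharP R p]
    (hsing : (∀ (q : Ideal R) (hq : q.IsPrime), q ≠ IsLocalRing.maximalIdeal R →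
        haveI := hq
        IsRegularLocalRingP (Localization.AtPrime q)) ∨ ringKrullDim R ≤ 2)
    (j : ℕ) (hj : 1 ≤ j)
    (htor : Subsingleton (TorGrp R j (AbsIntClo R) (IsLocalRing.ResidueField R))) :
    IsRegularLocalRingP R := by
  have := isRegularLocalRing_of_tor_absIntClo R hCM p hp j hj htor
  obtain ⟨s, hs, hspan⟩ :=
    (IsNoetherian.noetherian (IsLocalRing.maximalIdeal R)).exists_span_finset_card_eq_spanFinrank
  refine ⟨inferInstance, inferInstance, s, hspan, ?_⟩
  rw [hs, (isRegularLocalRing_iff R).mp this]
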